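/- arXiv:2409.17305 — 3 statements merged into one kernel-verified Lean document; each statement's English description precedes it below -/
import Mathlib

section
/- Let η ∈ ℝ and ℓ > −3/2 with 2ℓ+2 not a nonpositive integer (in particular ℓ ≠ −1 if η ≠ 0). Then every positive zero β of F′_{ℓ,η} satisfies β > η + √(η² + (ℓ+1)²); equivalently, if β > 0 and β φ′_{ℓ,η}(β) + (ℓ+1) φ_{ℓ,η}(β) = 0, then β > η + √(η² + (ℓ+1)²). -/
noncomputable def coulombCoeff (l η : ℝ) : ℕ → ℝ
  | 0 => 1
  | 1 => η / (l + 1)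
  | (k + 2) =>
      (2 * η * coulombCoeff l η (k + 1) - coulombCoeff l η k) /
        (((k : ℝ) + 2) * (((k : ℝ) + 2) + 2 * l + 1))

/-- The function φ_{ℓ,η}, real-valued on ℝ. -/
noncomputable def coulombPhi (l η x : ℝ) : ℝ := ∑' k : ℕ, coulombCoeff l η k * x ^ k

open Set Filter Topology

/-- A coefficient sequence decaying faster than every geometric sequence, i.e. the Taylor
coefficients of an entire function. -/
def EntireCoeff (c : ℕ → ℝ) : Prop := ∀ δ : ℝ, 0 < δ → ∃ C : ℝ, ∀ k, |c k| ≤ C * δ ^ k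

/-- The sum of the power series with coefficients `c`. -/
noncomputable def seriesSum (c : ℕ → ℝ) (x : ℝ) : ℝ := ∑' k : ℕ, c k * x ^ k

/-- The coefficients of the formal derivative. -/
def derivCoeff (c : ℕ → ℝ) (k : ℕ) : ℝ := ((k : ℝ) + 1) * c (k + 1)

lemma EntireCoeff.shift {c : ℕ → ℝ} (hc : EntireCoeff c) : EntireCoeff fun k => c (k + 1) := by
  intro δ hδ
  obtain ⟨C, hC⟩ := hc δ hδ
  refine ⟨C * δ, fun k => (hC (k + 1)).trans (le_of_eq (by ring))⟩

lemma EntireCoeff.derivCoeff {c : ℕ → ℝ} (hc : EntireCoeff c) : EntireCoeff (derivCoeff c) := by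
  intro δ hδ
  obtain ⟨C, hC⟩ := hc (δ / 2) (by positivity)
  refine ⟨C * δ, fun k => ?_⟩
  have h1 : ((k : ℝ) + 1) ≤ 2 ^ (k + 1) := by
    exact_mod_cast (Nat.lt_two_pow_self (n := k + 1)).le
  have h2 := hC (k + 1)
  have h3 : (0 : ℝ) ≤ (k : ℝ) + 1 := by positivity
  calc |((k : ℝ) + 1) * c (k + 1)| = ((k : ℝ) + 1) * |c (k + 1)| := by
        rw [abs_mul, abs_of_nonneg h3]
    _ ≤ 2 ^ (k + 1) * (C * (δ / 2) ^ (k + 1)) := by gcongr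
    _ = C * δ * δ ^ k := by
        rw [div_pow]; field_simp; ring

lemma EntireCoeff.summable_abs {c : ℕ → ℝ} (hc : EntireCoeff c) {R : ℝ} (hR : 0 < R) :
    Summable fun k => |c k| * R ^ k := by
  obtain ⟨C, hC⟩ := hc (1 / (2 * R)) (by positivity)
  refine Summable.of_nonneg_of_le (fun k => by positivity) (fun k => ?_)
    ((summable_geometric_of_lt_one (r := (1 / 2 : ℝ)) (by norm_num) (by norm_num)).mul_left C)
  calc |c k| * R ^ k ≤ C * (1 / (2 * R)) ^ k * R ^ k := by gcongr; exact hC k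
    _ = C * (1 / 2) ^ k := by
        rw [mul_assoc, ← mul_pow]; congr 2; field_simp

lemma EntireCoeff.hasSum {c : ℕ → ℝ} (hc : EntireCoeff c) (x : ℝ) :
    HasSum (fun k => c k * x ^ k) (seriesSum c x) := by
  refine Summable.hasSum (Summable.of_norm_bounded (hc.summable_abs (R := |x| + 1) (by positivity))
    fun k => ?_)
  rw [norm_mul, norm_pow, Real.norm_eq_abs, Real.norm_eq_abs]
  gcongr
  linarith

lemma EntireCoeff.hasSum_tail {c : ℕ → ℝ} (hc : EntireCoeff c) (x : ℝ) :
    HasSum (fun k => c (k + 1) * x ^ (k + 1)) (seriesSum c x - c 0) := by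
  have := (hasSum_nat_add_iff' 1).mpr (hc.hasSum x)
  simpa using this

lemma seriesSum_zero (c : ℕ → ℝ) : seriesSum c 0 = c 0 := by
  unfold seriesSum
  rw [tsum_eq_single 0 (fun k hk => by simp [hk])]
  simp

lemma EntireCoeff.hasDerivAt {c : ℕ → ℝ} (hc : EntireCoeff c) (x : ℝ) :
    HasDerivAt (seriesSum c) (seriesSum (_root_.derivCoeff c) x) x := by
  set R : ℝ := |x| + 1 with hR
  have hR0 : 0 < R := by positivity
  have key : HasDerivAt (fun y => ∑' k : ℕ, c (k + 1) * y ^ (k + 1))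
      (∑' k : ℕ, _root_.derivCoeff c k * x ^ k) x := by
    refine hasDerivAt_tsum_of_isPreconnected (t := Metric.ball (0 : ℝ) R) (y₀ := 0)
      (g := fun (k : ℕ) y => c (k + 1) * y ^ (k + 1))
      (g' := fun k y => _root_.derivCoeff c k * y ^ k)
      (hc.derivCoeff.summable_abs hR0) Metric.isOpen_ball
      (convex_ball (0 : ℝ) R).isPreconnected (fun k y _ => ?_) (fun k y hy => ?_) ?_ ?_ ?_
    · refine ((hasDerivAt_pow (k + 1) y).const_mul (c (k + 1))).congr_deriv ?_
      rw [_root_.derivCoeff, Nat.add_sub_cancel]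
      push_cast
      ring
    · rw [norm_mul, norm_pow, Real.norm_eq_abs, Real.norm_eq_abs]
      have hy' : |y| < R := by simpa using hy
      gcongr
    · simpa using hR0
    · exact (hc.hasSum_tail 0).summable
    · simp [hR]
  have heq : seriesSum c = fun y => c 0 + ∑' k : ℕ, c (k + 1) * y ^ (k + 1) := by
    funext y
    rw [(hc.hasSum_tail y).tsum_eq]
    ring
  rw [heq]
  exact key.const_add _

lemma entireCoeff_coulombCoeff (l η : ℝ) : EntireCoeff (coulombCoeff l η) := by
  intro δ hδ
  have hlin : Tendsto (fun k : ℕ => (k : ℝ) + 2 + 2 * l + 1) atTop atTop := by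
    have := tendsto_natCast_atTop_atTop (R := ℝ)
    exact (this.atTop_add (tendsto_const_nhds (x := 2 + 2 * l + 1))).congr fun k => by ring
  obtain ⟨N, hN⟩ := eventually_atTop.mp
    (hlin.eventually_ge_atTop (max 1 (max (2 * |2 * η| / δ) (2 / δ ^ 2))))
  set b : ℕ → ℝ := fun k => |coulombCoeff l η k| / δ ^ k with hb
  have hb0 : ∀ k, 0 ≤ b k := fun k => by positivity
  have hstep : ∀ k, N ≤ k → b (k + 2) ≤ (b (k + 1) + b k) / 2 := by
    intro k hk
    have h := hN k hk
    set q : ℝ := (k : ℝ) + 2 + 2 * l + 1 with hq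
    have h1 : 1 ≤ q := (le_max_left _ _).trans h
    have h2 : 2 * |2 * η| / δ ≤ q := ((le_max_left _ _).trans (le_max_right _ _)).trans h
    have h3 : 2 / δ ^ 2 ≤ q := ((le_max_right _ _).trans (le_max_right _ _)).trans h
    have h4 : q ≤ ((k : ℝ) + 2) * q := by
      have : (0 : ℝ) ≤ k := by positivity
      nlinarith
    have hpos : 0 < ((k : ℝ) + 2) * q := by linarith
    have e1 : |coulombCoeff l η (k + 1)| = b (k + 1) * δ ^ (k + 1) := by
      simp only [hb]; field_simp
    have e0 : |coulombCoeff l η k| = b k * δ ^ k := by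
      simp only [hb]; field_simp
    have h5 : |2 * η| * δ ≤ q * δ ^ 2 / 2 := by
      rw [div_le_iff₀ hδ] at h2
      nlinarith
    have h6 : 1 ≤ q * δ ^ 2 / 2 := by
      rw [div_le_iff₀ (by positivity)] at h3
      linarith
    have h7 : q * δ ^ 2 / 2 ≤ ((k : ℝ) + 2) * q * δ ^ 2 / 2 := by gcongr
    have hbound : |2 * η * coulombCoeff l η (k + 1) - coulombCoeff l η k| ≤
        (b (k + 1) + b k) / 2 * (δ ^ (k + 2)) * (((k : ℝ) + 2) * q) := by
      calc |2 * η * coulombCoeff l η (k + 1) - coulombCoeff l η k|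
          ≤ |2 * η * coulombCoeff l η (k + 1)| + |coulombCoeff l η k| := abs_sub _ _
        _ = (|2 * η| * δ) * (b (k + 1) * δ ^ k) + 1 * (b k * δ ^ k) := by
            rw [abs_mul, e1, e0]; ring
        _ ≤ (((k : ℝ) + 2) * q * δ ^ 2 / 2) * (b (k + 1) * δ ^ k)
            + (((k : ℝ) + 2) * q * δ ^ 2 / 2) * (b k * δ ^ k) := by
            have := hb0 k
            have := hb0 (k + 1)
            gcongr
            · exact h5.trans h7
            · exact h6.trans h7
        _ = _ := by ring
    have hdef : coulombCoeff l η (k + 2) =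
        (2 * η * coulombCoeff l η (k + 1) - coulombCoeff l η k) / (((k : ℝ) + 2) * q) := by
      rw [coulombCoeff]
    change |coulombCoeff l η (k + 2)| / δ ^ (k + 2) ≤ _
    rw [hdef, abs_div, abs_of_pos hpos, div_le_iff₀ (by positivity), div_le_iff₀ hpos]
    exact hbound
  set C : ℝ := ∑ k ∈ Finset.range (N + 2), b k with hC
  have hbC : ∀ k, b k ≤ C := by
    intro k
    induction k using Nat.strong_induction_on with
    | _ k ih =>
      by_cases hk : k < N + 2
      · exact Finset.single_le_sum (fun i _ => hb0 i) (Finset.mem_range.mpr hk)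
      · obtain ⟨j, rfl⟩ : ∃ j, k = j + 2 := ⟨k - 2, by omega⟩
        have := hstep j (by omega)
        have := ih j (by omega)
        have := ih (j + 1) (by omega)
        linarith
  exact ⟨C, fun k => (div_le_iff₀ (by positivity)).mp (hbC k)⟩

/-- The Coulomb wave equation in terms of `φ`. -/
lemma coulombPhi_ode (l η : ℝ) (hl : -3/2 < l) (hl1 : l + 1 ≠ 0) (x : ℝ) :
    x * seriesSum (derivCoeff (derivCoeff (coulombCoeff l η))) x
      + 2 * (l + 1) * seriesSum (derivCoeff (coulombCoeff l η)) x
      + (x - 2 * η) * seriesSum (coulombCoeff l η) x = 0 := by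
  have ha := entireCoeff_coulombCoeff l η
  have s := ((((ha.derivCoeff.derivCoeff.hasSum x).mul_left x).add
    ((ha.derivCoeff.hasSum_tail x).mul_left (2 * (l + 1)))).add
    ((ha.hasSum x).mul_left x)).sub ((ha.hasSum_tail x).mul_left (2 * η))
  have hz := s.unique (by
    convert hasSum_zero using 2 with k
    have hk : (0 : ℝ) ≤ k := by positivity
    have h1 : (k : ℝ) + 2 ≠ 0 := by positivity
    have h2 : (k : ℝ) + 2 + 2 * l + 1 ≠ 0 := by
      have : 0 < (k : ℝ) + 2 + 2 * l + 1 := by linarith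
      exact this.ne'
    have hr : ((k : ℝ) + 2) * ((k : ℝ) + 2 + 2 * l + 1) * coulombCoeff l η (k + 2) =
        2 * η * coulombCoeff l η (k + 1) - coulombCoeff l η k := by
      rw [coulombCoeff]; field_simp
    simp only [derivCoeff]
    push_cast
    rw [pow_succ]
    linear_combination x ^ k * x * hr)
  have h0 : (l + 1) * derivCoeff (coulombCoeff l η) 0 = η * coulombCoeff l η 0 := by
    simp only [derivCoeff, coulombCoeff]
    field_simp
    simp
  linear_combination hz + 2 * h0

/-- Positivity is preserved by a planar cooperative differential inequality. -/
lemma pos_of_cooperative {y z y' z' : ℝ → ℝ} {s t M : ℝ} (hst : s ≤ t)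
    (hy : ∀ x ∈ Icc s t, HasDerivAt y (y' x) x) (hz : ∀ x ∈ Icc s t, HasDerivAt z (z' x) x)
    (hys : 0 < y s) (hzs : 0 < z s)
    (hcoop : ∀ x ∈ Icc s t, 0 < y x → 0 < z x → 0 ≤ y' x + M * y x ∧ 0 ≤ z' x + M * z x) :
    0 < y t ∧ 0 < z t := by
  have mono : ∀ {w w' : ℝ → ℝ} {τ : ℝ}, s ≤ τ → (∀ x ∈ Icc s τ, HasDerivAt w (w' x) x) →
      (∀ x ∈ Ioo s τ, 0 ≤ w' x + M * w x) → 0 < w s → 0 < w τ := by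
    intro w w' τ hsτ hw hw' hws
    have hd : ∀ x ∈ Icc s τ, HasDerivAt (fun x => Real.exp (M * x) * w x)
        (Real.exp (M * x) * (w' x + M * w x)) x := by
      intro x hx
      have h1 : HasDerivAt (fun x => Real.exp (M * x)) (Real.exp (M * x) * (M * 1)) x :=
        ((hasDerivAt_id x).const_mul M).exp
      exact (h1.mul (hw x hx)).congr_deriv (by ring)
    have hm : MonotoneOn (fun x => Real.exp (M * x) * w x) (Icc s τ) := by
      refine monotoneOn_of_hasDerivWithinAt_nonneg (convex_Icc s τ)
        (fun x hx => (hd x hx).continuousAt.continuousWithinAt)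
        (fun x hx => (hd x (interior_subset hx)).hasDerivWithinAt) (fun x hx => ?_)
      rw [interior_Icc] at hx
      exact mul_nonneg (Real.exp_pos _).le (hw' x hx)
    have h := hm (left_mem_Icc.mpr hsτ) (right_mem_Icc.mpr hsτ) hsτ
    exact pos_of_mul_pos_right ((mul_pos (Real.exp_pos _) hws).trans_le h) (Real.exp_pos _).le
  by_contra hcon
  set A : Set ℝ := {x ∈ Icc s t | min (y x) (z x) ≤ 0} with hA
  have hcont : ContinuousOn (fun x => min (y x) (z x)) (Icc s t) :=
    ContinuousOn.inf (fun x hx => (hy x hx).continuousAt.continuousWithinAt)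
      (fun x hx => (hz x hx).continuousAt.continuousWithinAt)
  have hAc : IsClosed A := hcont.preimage_isClosed_of_isClosed isClosed_Icc isClosed_Iic
  have hAne : A.Nonempty := ⟨t, right_mem_Icc.mpr hst, by
    by_contra h
    exact hcon (lt_min_iff.mp (not_le.mp h))⟩
  have hAb : BddBelow A := ⟨s, fun x hx => hx.1.1⟩
  set τ := sInf A with hτ
  have hτA : τ ∈ A := hAc.csInf_mem hAne hAb
  have hbefore : ∀ x ∈ Ioo s τ, 0 < y x ∧ 0 < z x := by
    intro x hx
    by_contra h
    have : x ∈ A := ⟨⟨hx.1.le, hx.2.le.trans hτA.1.2⟩, by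
      by_contra h'
      exact h (lt_min_iff.mp (not_le.mp h'))⟩
    exact absurd (csInf_le hAb this) (not_le.mpr hx.2)
  have hsub : ∀ x ∈ Icc s τ, x ∈ Icc s t := fun x hx => ⟨hx.1, hx.2.trans hτA.1.2⟩
  have h1 := mono hτA.1.1 (fun x hx => hy x (hsub x hx)) (fun x hx =>
    (hcoop x (hsub x (Ioo_subset_Icc_self hx)) (hbefore x hx).1 (hbefore x hx).2).1) hys
  have h2 := mono hτA.1.1 (fun x hx => hz x (hsub x hx)) (fun x hx =>
    (hcoop x (hsub x (Ioo_subset_Icc_self hx)) (hbefore x hx).1 (hbefore x hx).2).2) hzs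
  exact absurd hτA.2 (not_le.mpr (lt_min h1 h2))

/-- Below the bound, `L / x + η / L` dominates `√(1 + η² / L²)` in absolute value. -/
lemma sq_le_of_le_bound {η L x : ℝ} (hL : L ≠ 0) (hx : 0 < x)
    (hxb : x ≤ η + Real.sqrt (η ^ 2 + L ^ 2)) :
    1 + (η / L) ^ 2 ≤ (L / x + η / L) ^ 2 ∧ 0 < L * (L / x + η / L) := by
  have hL2 : 0 < L ^ 2 := by positivity
  have hle : (x - η) ^ 2 ≤ η ^ 2 + L ^ 2 := by
    have h0 : -x + η ≤ Real.sqrt (η ^ 2 + L ^ 2) := by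
      have : η ≤ Real.sqrt (η ^ 2 + L ^ 2) := Real.le_sqrt_of_sq_le (by linarith)
      linarith
    have := Real.sq_sqrt (show 0 ≤ η ^ 2 + L ^ 2 by positivity)
    rw [← this]
    exact sq_le_sq' (by linarith) (by linarith)
  have hpoly : 0 ≤ L ^ 2 + 2 * η * x - x ^ 2 := by nlinarith
  constructor
  · have : (L / x + η / L) ^ 2 - (1 + (η / L) ^ 2) = (L ^ 2 + 2 * η * x - x ^ 2) / x ^ 2 := by
      field_simp
      ring
    have h2 : 0 ≤ (L ^ 2 + 2 * η * x - x ^ 2) / x ^ 2 := by positivity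
    linarith
  · have : L * (L / x + η / L) = (L ^ 2 + η * x) / x := by field_simp
    rw [this]
    apply div_pos _ hx
    nlinarith [sq_nonneg x]

section Comparison

variable {f f' f'' : ℝ → ℝ} {η L β : ℝ}

lemma deriv_ne_zero_of_pos (hL : 0 < L) (hβ : 0 < β)
    (hβb : β ≤ η + Real.sqrt (η ^ 2 + L ^ 2))
    (hf : ∀ x, HasDerivAt f (f' x) x) (hf' : ∀ x, HasDerivAt f' (f'' x) x)
    (hode : ∀ x, x * f'' x + 2 * L * f' x + (x - 2 * η) * f x = 0)
    (h0 : f 0 = 1) (h0' : f' 0 = η / L) : β * f' β + L * f β ≠ 0 := by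
  obtain ⟨c, hc⟩ : ∃ c, c = η / L := ⟨_, rfl⟩
  have hη : η = c * L := by rw [hc, div_mul_cancel₀ η hL.ne']
  rw [← hc] at h0'
  set r := Real.sqrt (1 + c ^ 2) with hr
  have hr2 : r ^ 2 = 1 + c ^ 2 := Real.sq_sqrt (by positivity)
  have hr0 : 0 < r := Real.sqrt_pos.mpr (by positivity)
  have hS : ∀ x ∈ Ioc 0 β, r ≤ L / x + c := by
    intro x hx
    obtain ⟨h1, h2⟩ := sq_le_of_le_bound hL.ne' hx.1 (hx.2.trans hβb)
    rw [← hc] at h1 h2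
    exact Real.sqrt_le_iff.mpr ⟨(pos_of_mul_pos_right h2 hL.le).le, h1⟩
  set a : ℝ → ℝ := fun x => (r - c) * f x + f' x with ha
  set b : ℝ → ℝ := fun x => (r + c) * f x - f' x with hb
  have hda : ∀ x, HasDerivAt a ((r - c) * f' x + f'' x) x := fun x =>
    ((hf x).const_mul _).add (hf' x)
  have hdb : ∀ x, HasDerivAt b ((r + c) * f' x - f'' x) x := fun x =>
    ((hf x).const_mul _).sub (hf' x)
  have ha0 : 0 < a 0 := by simp only [ha, h0, h0']; linarith
  have hb0 : 0 < b 0 := by simp only [hb, h0, h0']; linarith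
  have hev : ∀ᶠ x in 𝓝[>] (0 : ℝ), 0 < a x ∧ 0 < b x ∧ x ∈ Ioo 0 β :=
    ((hda 0).continuousAt.eventually_const_lt ha0 |>.filter_mono nhdsWithin_le_nhds).and
      (((hdb 0).continuousAt.eventually_const_lt hb0 |>.filter_mono nhdsWithin_le_nhds).and
        (Ioo_mem_nhdsGT hβ))
  obtain ⟨s, hsa, hsb, hs⟩ := hev.exists
  have hpos := pos_of_cooperative (M := L / s) hs.2.le (fun x _ => hda x) (fun x _ => hdb x)
    hsa hsb (by
      intro x hx hax hbx
      have hx0 : 0 < x := hs.1.trans_le hx.1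
      have hSx := hS x ⟨hx0, hx.2⟩
      have hLx : L / x ≤ L / s := div_le_div_of_nonneg_left hL.le hs.1 hx.1
      have hf2 : f'' x = -2 * (L / x) * f' x - (1 - 2 * c * (L / x)) * f x := by
        have := hode x
        rw [hη] at this
        field_simp
        linear_combination this
      have e1 : (r - c) * f' x + f'' x = (L / x + c - r) * b x - L / x * a x := by
        simp only [ha, hb]
        rw [hf2]
        linear_combination (f x) * hr2
      have e2 : (r + c) * f' x - f'' x = (L / x + c + r) * a x - L / x * b x := by
        simp only [ha, hb]
        rw [hf2]
        linear_combination (-f x) * hr2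
      rw [e1, e2]
      have p1 : 0 ≤ (L / x + c - r) * b x := mul_nonneg (by linarith) hbx.le
      have p2 : 0 ≤ (L / x + c + r) * a x := mul_nonneg (by linarith) hax.le
      constructor <;> nlinarith)
  have hSβ := hS β ⟨hβ, le_rfl⟩
  have hfin : 2 * r * (f' β + L / β * f β) =
      (L / β + c + r) * a β + (L / β + c - r) * b β := by
    simp only [ha, hb]
    ring
  have hgt : 0 < (L / β + c + r) * a β := mul_pos (by linarith) hpos.1
  have hge : 0 ≤ (L / β + c - r) * b β := mul_nonneg (by linarith) hpos.2.le
  intro hzero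
  have : f' β + L / β * f β = 0 := by
    field_simp
    linarith
  rw [this] at hfin
  linarith

lemma deriv_ne_zero_of_neg (hL : L < 0) (hL2 : -1 / 2 < L) (hβ : 0 < β)
    (hβb : β ≤ η + Real.sqrt (η ^ 2 + L ^ 2))
    (hf : ∀ x, HasDerivAt f (f' x) x) (hf' : ∀ x, HasDerivAt f' (f'' x) x)
    (hode : ∀ x, x * f'' x + 2 * L * f' x + (x - 2 * η) * f x = 0)
    (h0 : f 0 = 1) (h0' : f' 0 = η / L)
    (h0'' : (2 * L + 1) * f'' 0 = 2 * η * (η / L) - 1) : β * f' β + L * f β ≠ 0 := by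
  obtain ⟨c, hc⟩ : ∃ c, c = η / L := ⟨_, rfl⟩
  have hη : η = c * L := by rw [hc, div_mul_cancel₀ η hL.ne]
  rw [← hc] at h0' h0''
  have hS : ∀ x ∈ Ioc 0 β, 1 + c ^ 2 ≤ (L / x + c) ^ 2 ∧ L / x + c ≤ -1 := by
    intro x hx
    obtain ⟨h1, h2⟩ := sq_le_of_le_bound hL.ne hx.1 (hx.2.trans hβb)
    rw [← hc] at h1 h2
    refine ⟨h1, ?_⟩
    have : L / x + c < 0 := by
      by_contra h
      nlinarith
    nlinarith [sq_nonneg c]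
  set G : ℝ → ℝ := fun x => c * f x - f' x with hG
  set p : ℝ → ℝ := fun x => -(L * (x⁻¹ * f x) + f' x) with hp
  have hdG : ∀ x, HasDerivAt G (c * f' x - f'' x) x := fun x =>
    ((hf x).const_mul _).sub (hf' x)
  have hdp : ∀ x, x ≠ 0 → HasDerivAt p
      (-(L * (-(x ^ 2)⁻¹ * f x + x⁻¹ * f' x) + f'' x)) x := fun x hx =>
    ((((hasDerivAt_inv hx).mul (hf x)).const_mul L).add (hf' x)).neg
  have hG0 : G 0 = 0 := by simp [hG, h0, h0']
  have hG0' : 0 < c * f' 0 - f'' 0 := by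
    have : (2 * L + 1) * (c * f' 0 - f'' 0) = c ^ 2 + 1 := by
      rw [hη] at h0''
      rw [h0']
      linear_combination -h0''
    exact pos_of_mul_pos_right (this.symm ▸ (by positivity : 0 < c ^ 2 + 1))
      (by linarith : 0 ≤ 2 * L + 1)
  have hGev : ∀ᶠ x in 𝓝[>] (0 : ℝ), 0 < G x := by
    have h := (hasDerivAt_iff_tendsto_slope.mp (hdG 0)).eventually_const_lt hG0'
    have h' := h.filter_mono (nhdsWithin_mono 0 (fun x (hx : 0 < x) => hx.ne'))
    filter_upwards [h', self_mem_nhdsWithin] with x hx hx0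
    rw [slope_def_field, hG0, sub_zero, sub_zero] at hx
    exact (div_pos_iff_of_pos_right hx0).mp hx
  have hpev : ∀ᶠ x in 𝓝[>] (0 : ℝ), 0 < p x := by
    have hcont : ContinuousAt (fun x => -(L * f x + x * f' x)) 0 :=
      (((hf 0).continuousAt.const_mul L).add (continuousAt_id.mul (hf' 0).continuousAt)).neg
    have h := (hcont.eventually_const_lt (u := 0) (by simp [h0, hL])).filter_mono
      (nhdsWithin_le_nhds (s := Ioi 0))
    filter_upwards [h, self_mem_nhdsWithin] with x hx hx0
    have hx0' : (0 : ℝ) < x := hx0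
    have : p x = -(L * f x + x * f' x) / x := by
      simp only [hp]
      field_simp
    rw [this]
    exact div_pos hx hx0'
  obtain ⟨s, hsG, hsp, hs⟩ := (hGev.and (hpev.and (Ioo_mem_nhdsGT hβ))).exists
  have hpos := pos_of_cooperative (M := (-L / s + |c|) - L / s ^ 2) hs.2.le (fun x _ => hdG x)
    (fun x hx => hdp x (hs.1.trans_le hx.1).ne') hsG hsp (by
      intro x hx hGx hpx
      have hx0 : 0 < x := hs.1.trans_le hx.1
      obtain ⟨hSx, hSn⟩ := hS x ⟨hx0, hx.2⟩
      have hLx : -L / x ≤ -L / s := div_le_div_of_nonneg_left (by linarith) hs.1 hx.1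
      have hLx2 : -L / x ^ 2 ≤ -L / s ^ 2 :=
        div_le_div_of_nonneg_left (by linarith) (pow_pos hs.1 2)
          (pow_le_pow_left₀ hs.1.le hx.1 2)
      have hLx0 : 0 < -L / x := div_pos (by linarith) hx0
      have hLx20 : 0 < -L / x ^ 2 := div_pos (by linarith) (by positivity)
      have hf2 : f'' x = -2 * (L / x) * f' x - (1 - 2 * c * (L / x)) * f x := by
        have := hode x
        rw [hη] at this
        field_simp
        linear_combination this
      obtain ⟨σ, hσ⟩ : ∃ σ, σ = -(L / x + c) := ⟨_, rfl⟩
      have hσ1 : 1 ≤ σ := by linarith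
      have hσ2 : 1 + c ^ 2 ≤ σ ^ 2 := by rw [hσ, neg_sq]; exact hSx
      obtain ⟨Q, hQ⟩ : ∃ Q, Q = σ ^ 2 - (1 + c ^ 2) + -L / x ^ 2 := ⟨_, rfl⟩
      have hQ0 : 0 ≤ Q := by linarith
      have hp' : p x = G x + σ * f x := by
        simp only [hp, hG, hσ]
        field_simp
        ring
      have hfx : f x = (p x - G x) / σ := by
        rw [hp']
        field_simp
        ring
      have e1 : c * f' x - f'' x = (1 + c ^ 2) * f x + (σ + -L / x) * G x := by
        rw [hf2, hσ]
        simp only [hG]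
        ring
      have e2 : -(L * (-(x ^ 2)⁻¹ * f x + x⁻¹ * f' x) + f'' x) = -L / x * p x - Q * f x := by
        rw [hf2, hQ, hσ]
        simp only [hp]
        field_simp
        ring
      have hσM : σ ≤ -L / s + |c| := by
        have := neg_abs_le c
        have e : -L / x = -(L / x) := by ring
        rw [hσ]
        linarith
      have hM : 0 ≤ (-L / s + |c|) - L / s ^ 2 - Q / σ := by
        have h1 : Q / σ ≤ σ + -L / x ^ 2 := by
          rw [div_le_iff₀ (by linarith), hQ]
          nlinarith [sq_nonneg c]
        have e : -L / s ^ 2 = -(L / s ^ 2) := by ring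
        linarith
      have hQσ : 0 ≤ Q / σ := div_nonneg hQ0 (by linarith)
      rw [e1, e2]
      constructor
      · have e3 : (1 + c ^ 2) * f x + (σ + -L / x) * G x =
            (1 + c ^ 2) / σ * p x + ((σ ^ 2 - (1 + c ^ 2)) / σ + -L / x) * G x := by
          rw [hfx]
          field_simp
          ring
        have t1 : 0 ≤ (1 + c ^ 2) / σ * p x := by positivity
        have t2 : 0 ≤ ((σ ^ 2 - (1 + c ^ 2)) / σ + -L / x) * G x :=
          mul_nonneg (add_nonneg (div_nonneg (by linarith) (by linarith)) hLx0.le) hGx.le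
        have t3 : 0 ≤ ((-L / s + |c|) - L / s ^ 2) * G x := mul_nonneg (by linarith) hGx.le
        linarith
      · have e3 : -L / x * p x - Q * f x = -L / x * p x + Q / σ * G x - Q / σ * p x := by
          rw [hfx]
          ring
        have t1 : 0 ≤ -L / x * p x := mul_nonneg hLx0.le hpx.le
        have t2 : 0 ≤ Q / σ * G x := mul_nonneg hQσ hGx.le
        have t3 := mul_nonneg hM hpx.le
        rw [e3]
        linarith)
  intro hzero
  have hpβ : p β = -(β * f' β + L * f β) / β := by
    simp only [hp]
    field_simp
    ring
  rw [hzero] at hpβ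
  have := hpos.2
  rw [hpβ] at this
  simp at this

end Comparison

/-- Lemma 2.2: the positive zeros of F'_{ℓ,η} (equivalently, the positive solutions of
β φ'_{ℓ,η}(β) + (ℓ+1) φ_{ℓ,η}(β) = 0) are bounded below by η + √(η² + (ℓ+1)²). -/
theorem stmt_1 (l η : ℝ) (hl : -3/2 < l) (hl2 : ∀ n : ℕ, 2 * l + 2 ≠ -(n : ℝ)) :
    ∀ β : ℝ, 0 < β → β * deriv (coulombPhi l η) β + (l + 1) * coulombPhi l η β = 0 →
      β > η + Real.sqrt (η ^ 2 + (l + 1) ^ 2) := by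
  intro β hβ hzero
  by_contra hcon
  have hle := not_lt.mp hcon
  have hL : l + 1 ≠ 0 := fun h => hl2 0 (by push_cast; linarith)
  have ha := entireCoeff_coulombCoeff l η
  have hphi : coulombPhi l η = seriesSum (coulombCoeff l η) := rfl
  rw [hphi, (ha.hasDerivAt β).deriv] at hzero
  have h0 : seriesSum (coulombCoeff l η) 0 = 1 := by
    rw [seriesSum_zero, coulombCoeff]
  have h0' : seriesSum (derivCoeff (coulombCoeff l η)) 0 = η / (l + 1) := by
    simp [seriesSum_zero, derivCoeff, coulombCoeff]
  rcases lt_or_gt_of_ne hL with hneg | hpos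
  · refine deriv_ne_zero_of_neg hneg (by linarith) hβ hle ha.hasDerivAt
      ha.derivCoeff.hasDerivAt (coulombPhi_ode l η hl hL) h0 h0' ?_ hzero
    have h3 : 2 + 2 * l + 1 ≠ 0 := by
      have : 0 < 2 + 2 * l + 1 := by linarith
      exact this.ne'
    have h2 : coulombCoeff l η 2 * (2 * (2 + 2 * l + 1)) = 2 * η * (η / (l + 1)) - 1 := by
      simp only [coulombCoeff]
      push_cast
      rw [zero_add, div_mul_cancel₀ _ (mul_ne_zero two_ne_zero h3)]
    simp only [seriesSum_zero, derivCoeff]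
    norm_num
    linear_combination h2
  · exact deriv_ne_zero_of_pos hpos hβ hle ha.hasDerivAt
      ha.derivCoeff.hasDerivAt (coulombPhi_ode l η hl hL) h0 h0' hzero
end

section
/- Let η, ℓ ∈ ℝ with ℓ > −3/2, ℓ ≠ −1 and η ≠ 0 (and 2ℓ+2 not a nonpositive integer). Then φ_{ℓ,η} and φ_{ℓ+1,η} each have infinitely many positive zeros, all simple, with no positive zero in common, and their positive zeros strictly interlace according to the pattern 0 < ρ_{ℓ,η,1} < ρ_{ℓ+1,η,1} < ρ_{ℓ,η,2} < ρ_{ℓ+1,η,2} < ⋯ ; that is, ρ_{ℓ,η,k} < ρ_{ℓ+1,η,k} < ρ_{ℓ,η,k+1} for every k ≥ 1. -/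
/-- `ρ : ℕ → ℝ` enumerates all the positive zeros of `f` in (strictly) increasing order,
`ρ k` being the (k+1)-st positive zero. -/
def IsPosZeroEnum (f : ℝ → ℝ) (ρ : ℕ → ℝ) : Prop :=
  StrictMono ρ ∧ (∀ k, 0 < ρ k ∧ f (ρ k) = 0) ∧ ∀ x, 0 < x → f x = 0 → ∃ k, ρ k = x

open Set Filter Topology

section PowerSeries

variable {a : ℕ → ℝ} {M : ℝ}

lemma summable_mul_pow_of_abs_le (h : ∀ k, |a k| ≤ M ^ k / k.factorial) (x : ℝ) :
    Summable fun k => a k * x ^ k := by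
  refine Summable.of_norm_bounded (Real.summable_pow_div_factorial (M * |x|)) fun k => ?_
  rw [Real.norm_eq_abs, abs_mul, abs_pow, mul_pow, mul_div_right_comm]
  exact mul_le_mul_of_nonneg_right (h k) (by positivity)

lemma abs_succ_mul_le (h : ∀ k, |a k| ≤ M ^ k / k.factorial) (k : ℕ) :
    |((k : ℝ) + 1) * a (k + 1)| ≤ M * (M ^ k / k.factorial) := by
  have hk : (0 : ℝ) < k + 1 := by positivity
  rw [abs_mul, abs_of_pos hk]
  calc ((k : ℝ) + 1) * |a (k + 1)| ≤ (k + 1) * (M ^ (k + 1) / (k + 1).factorial) := by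
        gcongr; exact h _
    _ = M * (M ^ k / k.factorial) := by
        rw [Nat.factorial_succ]; push_cast; field_simp; ring

lemma summable_succ_mul_pow_of_abs_le (h : ∀ k, |a k| ≤ M ^ k / k.factorial) (x : ℝ) :
    Summable fun k : ℕ => ((k : ℝ) + 1) * a (k + 1) * x ^ k := by
  refine Summable.of_norm_bounded
    ((Real.summable_pow_div_factorial (M * |x|)).mul_left M) fun k => ?_
  rw [Real.norm_eq_abs, abs_mul, abs_pow, mul_pow]
  calc _ ≤ M * (M ^ k / k.factorial) * |x| ^ k :=
        mul_le_mul_of_nonneg_right (abs_succ_mul_le h k) (by positivity)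
    _ = _ := by ring

lemma hasDerivAt_tsum_mul_pow (h : ∀ k, |a k| ≤ M ^ k / k.factorial) (x : ℝ) :
    HasDerivAt (fun y => ∑' k, a k * y ^ k)
      (∑' k : ℕ, ((k : ℝ) + 1) * a (k + 1) * x ^ k) x := by
  set R := |x| + 1 with hR
  have hR0 : 0 ≤ R := by positivity
  have habs : ∀ k, |(|a k|)| ≤ M ^ k / k.factorial := fun k => by simpa using h k
  have hu : Summable fun k : ℕ => |a k| * (k * R ^ (k - 1)) := by
    rw [← summable_nat_add_iff 1]
    refine (summable_succ_mul_pow_of_abs_le habs R).congr fun k => ?_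
    simp only [Nat.add_sub_cancel]
    push_cast
    ring
  have hbound : ∀ (k : ℕ) (y : ℝ), y ∈ Metric.ball (0 : ℝ) R →
      ‖a k * (k * y ^ (k - 1))‖ ≤ |a k| * (k * R ^ (k - 1)) := fun k y hy => by
    have hy' : |y| ≤ R := by simpa using (mem_ball_zero_iff.1 hy).le
    rw [Real.norm_eq_abs, abs_mul, abs_mul, abs_pow, Nat.abs_cast]
    gcongr
  have hx : x ∈ Metric.ball (0 : ℝ) R := by simp [hR]
  have key := hasDerivAt_tsum_of_isPreconnected hu Metric.isOpen_ball
    (convex_ball (0 : ℝ) R).isPreconnected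
    (fun k y _ => (hasDerivAt_pow k y).const_mul (a k)) hbound hx
    (summable_mul_pow_of_abs_le h x) hx
  have hs : Summable fun k : ℕ => a k * (k * x ^ (k - 1)) :=
    Summable.of_norm_bounded hu fun k => hbound k x hx
  have heq : ∑' k : ℕ, a k * (k * x ^ (k - 1)) =
      ∑' k : ℕ, ((k : ℝ) + 1) * a (k + 1) * x ^ k := by
    rw [hs.tsum_eq_zero_add]
    simp only [Nat.cast_zero, zero_mul, mul_zero, zero_add, Nat.add_sub_cancel]
    refine tsum_congr fun k => ?_
    push_cast
    ring
  exact heq ▸ key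

end PowerSeries

section Coefficients

variable {l η : ℝ}

lemma coulombCoeff_rec (hl : -3/2 < l) (k : ℕ) :
    ((k : ℝ) + 2) * (k + (2 * l + 3)) * coulombCoeff l η (k + 2) =
      2 * η * coulombCoeff l η (k + 1) - coulombCoeff l η k := by
  have h1 : (0 : ℝ) < k + 2 := by positivity
  have h2 : (0 : ℝ) < k + 2 + 2 * l + 1 := by
    have : (0 : ℝ) ≤ k := k.cast_nonneg
    linarith
  rw [coulombCoeff]
  field_simp
  ring

lemma exists_abs_coulombCoeff_le (η : ℝ) (hl : -3/2 < l) :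
    ∃ M : ℝ, ∀ k, |coulombCoeff l η k| ≤ M ^ k / k.factorial := by
  set δ := min 1 (2 * l + 3) / 2 with hδ
  have hδ0 : 0 < δ := by
    have : 0 < min 1 (2 * l + 3) := lt_min one_pos (by linarith)
    positivity
  set M := 1 + |η / (l + 1)| + (2 * |η| + 1) / δ with hM
  have hM1 : 1 ≤ M := by
    have : 0 ≤ |η / (l + 1)| + (2 * |η| + 1) / δ := by positivity
    linarith
  have hMα : |η / (l + 1)| ≤ M := by
    have : 0 ≤ (2 * |η| + 1) / δ := by positivity
    linarith
  have hMδ : 2 * |η| + 1 ≤ δ * M := by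
    have h1 : δ * ((2 * |η| + 1) / δ) = 2 * |η| + 1 := by field_simp
    have h2 : 0 ≤ δ * (1 + |η / (l + 1)|) := by positivity
    rw [hM, mul_add, h1]
    linarith
  refine ⟨M, fun k => ?_⟩
  induction k using Nat.twoStepInduction with
  | zero => simp [coulombCoeff]
  | one => simpa [coulombCoeff] using hMα
  | more k ih0 ih1 =>
    have hk : (0 : ℝ) ≤ k := k.cast_nonneg
    have hden : δ * (k + 2) ≤ k + (2 * l + 3) := by
      have h1 : 2 * δ ≤ 1 := by rw [hδ]; linarith [min_le_left 1 (2 * l + 3)]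
      have h2 : 2 * δ ≤ 2 * l + 3 := by rw [hδ]; linarith [min_le_right 1 (2 * l + 3)]
      nlinarith
    have hpos : 0 < δ * ((k : ℝ) + 2) := by positivity
    have hrec := congrArg abs (coulombCoeff_rec (η := η) hl k)
    rw [abs_mul, abs_of_pos (mul_pos (by positivity) (hpos.trans_le hden))] at hrec
    have hM0 : 0 < M := by linarith
    have hfac : ((k + 2).factorial : ℝ) = (k + 2) * ((k + 1) * k.factorial) := by
      rw [Nat.factorial_succ, Nat.factorial_succ]; push_cast; ring
    have hfac1 : ((k + 1).factorial : ℝ) = (k + 1) * k.factorial := by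
      rw [Nat.factorial_succ]; push_cast; ring
    have hup : |2 * η * coulombCoeff l η (k + 1) - coulombCoeff l η k| ≤
        2 * |η| * (M ^ (k + 1) / (k + 1).factorial) + M ^ k / k.factorial := by
      refine (abs_sub _ _).trans (add_le_add ?_ ih0)
      rw [abs_mul, abs_mul, abs_two]
      gcongr
    have hmain : 2 * |η| * (M ^ (k + 1) / (k + 1).factorial) + M ^ k / k.factorial ≤
        (k + 2) * (δ * (k + 2)) * (M ^ (k + 2) / (k + 2).factorial) := by
      have hf : (0 : ℝ) < k.factorial := by exact_mod_cast k.factorial_pos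
      have e1 : (k + 2) * (δ * (k + 2)) * (M ^ (k + 2) / (k + 2).factorial) =
          (k + 2) * (δ * M) * M * (M ^ k / ((k + 1) * k.factorial)) := by
        rw [hfac]; field_simp; ring
      have e2 : 2 * |η| * (M ^ (k + 1) / (k + 1).factorial) + M ^ k / k.factorial =
          (2 * |η| * M + (k + 1)) * (M ^ k / ((k + 1) * k.factorial)) := by
        rw [hfac1]; field_simp; ring
      rw [e1, e2]
      gcongr
      have := abs_nonneg η
      calc 2 * |η| * M + (k + 1) ≤ (k + 2) * (2 * |η| + 1) * M := by
            nlinarith [mul_nonneg hk this, mul_nonneg (mul_nonneg hk this) hM0.le,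
              mul_nonneg this hM0.le]
        _ ≤ (k + 2) * (δ * M) * M := by gcongr
    have hle : (k + 2) * (δ * (k + 2)) * |coulombCoeff l η (k + 2)| ≤
        (k + 2) * (δ * (k + 2)) * (M ^ (k + 2) / (k + 2).factorial) := by
      refine le_trans ?_ (hup.trans hmain)
      rw [← hrec]
      gcongr
    exact le_of_mul_le_mul_left hle (by positivity)

/-- The positive constant relating `φ_{ℓ+1,η}` to `φ_{ℓ,η}` and its derivative. -/
noncomputable def coulombConst (l η : ℝ) : ℝ := ((η / (l + 1)) ^ 2 + 1) / (2 * l + 3)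

lemma coulombConst_pos (hl : -3/2 < l) : 0 < coulombConst l η :=
  div_pos (by positivity) (by linarith)

lemma coulombConst_mul (hl : -3/2 < l) :
    coulombConst l η * (2 * l + 3) = (η / (l + 1)) ^ 2 + 1 :=
  div_mul_cancel₀ _ (by linarith)

lemma coulombCoeff_second_relation (hl : -3/2 < l) {α : ℝ} (hα : α * (l + 1) = η) (k : ℕ) :
    ((k : ℝ) + 1 + (2 * l + 3)) *
        (α * coulombCoeff l η (k + 2) - (k + 3) * coulombCoeff l η (k + 3)) =
      (α ^ 2 + 1) * coulombCoeff l η (k + 1) -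
        α * (α * coulombCoeff l η (k + 1) - (k + 2) * coulombCoeff l η (k + 2)) := by
  have h := coulombCoeff_rec (η := η) hl (k + 1)
  rw [show k + 1 + 2 = k + 3 from rfl, show k + 1 + 1 = k + 2 from rfl] at h
  push_cast at h
  linear_combination -h + 2 * coulombCoeff l η (k + 2) * hα

lemma coulombConst_mul_coeff (hl : -3/2 < l) (hl1 : l ≠ -1) (k : ℕ) :
    coulombConst l η * coulombCoeff (l + 1) η k =
      η / (l + 1) * coulombCoeff l η (k + 1) - (k + 2) * coulombCoeff l η (k + 2) := by
  have hl1' : l + 1 ≠ 0 := fun h => hl1 (by linarith)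
  obtain ⟨α, hα⟩ : ∃ α, α = η / (l + 1) := ⟨_, rfl⟩
  have hη : α * (l + 1) = η := by rw [hα]; field_simp
  have hc := coulombConst_mul (η := η) hl
  rw [← hα] at hc ⊢
  have hd : 0 < 2 * l + 3 := by linarith
  have ha0 : coulombCoeff l η 0 = 1 := rfl
  have ha1 : coulombCoeff l η 1 = α := hα.symm
  have hrec0 := coulombCoeff_rec (η := η) hl 0
  have hfst := coulombCoeff_second_relation hl hη
  have hzero : coulombConst l η =
      α * coulombCoeff l η 1 - 2 * coulombCoeff l η 2 := by
    refine mul_right_cancel₀ hd.ne' ?_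
    simp only [Nat.cast_zero, zero_add] at hrec0
    rw [ha1, ha0] at hrec0
    rw [ha1]
    linear_combination hc + hrec0 - 2 * α * hη
  induction k using Nat.twoStepInduction with
  | zero =>
    have hb : coulombCoeff (l + 1) η 0 = 1 := rfl
    simpa [hb] using hzero
  | one =>
    have h2 : 0 < l + 2 := by linarith
    have hb : (l + 2) * coulombCoeff (l + 1) η 1 = η := by
      rw [coulombCoeff, show l + 1 + 1 = l + 2 by ring]
      field_simp
    have h0 := hfst 0
    simp only [Nat.cast_zero, zero_add] at h0
    rw [← hzero, ha1] at h0
    refine mul_left_cancel₀ h2.ne' ?_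
    push_cast
    rw [show (1 : ℝ) + 2 = 3 by norm_num]
    linear_combination coulombConst l η * hb - coulombConst l η * hη - h0 / 2 + α / 2 * hc
  | more k ih0 ih1 =>
    have hk : (0 : ℝ) ≤ k := k.cast_nonneg
    have hrec' := coulombCoeff_rec (η := η) (l := l + 1) (by linarith) k
    have h0 := hfst k
    have h1 := hfst (k + 1)
    rw [show k + 1 + 2 = k + 3 from rfl, show k + 1 + 1 = k + 2 from rfl] at h1 ih1
    rw [show k + 1 + 3 = k + 4 from rfl] at h1
    rw [show k + 2 + 2 = k + 4 from rfl, show k + 2 + 1 = k + 3 from rfl]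
    push_cast at h1 ih1 ⊢
    refine mul_left_cancel₀
      (mul_pos (by positivity : (0 : ℝ) < k + 2) (by linarith : 0 < k + (2 * (l + 1) + 3))).ne' ?_
    set a1 := coulombCoeff l η (k + 1)
    set a2 := coulombCoeff l η (k + 2)
    set a3 := coulombCoeff l η (k + 3)
    linear_combination coulombConst l η * hrec' + 2 * η * ih1 - ih0 - (k + 2) * h1 + α * h0
      - 2 * (α * a2 - (k + 3) * a3) * hη

lemma coulombCoeff_succ_relation (hl : -3/2 < l) (hl1 : l ≠ -1) (k : ℕ) :
    ((k : ℝ) + 1 + (2 * l + 3)) * coulombCoeff (l + 1) η (k + 1) =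
      (2 * l + 3) * coulombCoeff l η (k + 1) - η / (l + 1) * coulombCoeff (l + 1) η k := by
  have hl1' : l + 1 ≠ 0 := fun h => hl1 (by linarith)
  have h := coulombCoeff_second_relation hl (div_mul_cancel₀ η hl1') k
  have h0 := coulombConst_mul_coeff (η := η) hl hl1 k
  have h1 := coulombConst_mul_coeff (η := η) hl hl1 (k + 1)
  rw [show k + 1 + 2 = k + 3 from rfl, show k + 1 + 1 = k + 2 from rfl] at h1
  push_cast at h1
  refine mul_left_cancel₀ (coulombConst_pos (η := η) hl).ne' ?_
  linear_combination h + (k + 1 + (2 * l + 3)) * h1 + η / (l + 1) * h0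
    - coulombCoeff l η (k + 1) * coulombConst_mul (η := η) hl

end Coefficients

section Functions

variable {l η : ℝ}

lemma coulombPhi_zero (l η : ℝ) : coulombPhi l η 0 = 1 := by
  rw [coulombPhi, tsum_eq_single 0 fun k hk => by simp [hk]]
  simp [coulombCoeff]

lemma hasDerivAt_coulombPhi (hl : -3/2 < l) (hl1 : l ≠ -1) (x : ℝ) :
    HasDerivAt (coulombPhi l η)
      (η / (l + 1) * coulombPhi l η x - coulombConst l η * x * coulombPhi (l + 1) η x) x := by
  obtain ⟨M, hM⟩ := exists_abs_coulombCoeff_le η hl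
  obtain ⟨N, hN⟩ := exists_abs_coulombCoeff_le (l := l + 1) η (by linarith)
  have hphi := summable_mul_pow_of_abs_le hM x
  have hpsi := summable_mul_pow_of_abs_le hN x
  have hder := summable_succ_mul_pow_of_abs_le hM x
  refine (hasDerivAt_tsum_mul_pow hM x).congr_deriv ?_
  have hshift : Summable fun k => coulombCoeff l η (k + 1) * x ^ (k + 1) :=
    (summable_nat_add_iff 1).2 hphi
  rw [hder.tsum_eq_zero_add, coulombPhi, coulombPhi, hphi.tsum_eq_zero_add, mul_add,
    ← tsum_mul_left, ← tsum_mul_left, add_sub_assoc, ← (hshift.mul_left _).tsum_sub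
    (hpsi.mul_left _)]
  congr 1
  · simp [coulombCoeff]
  · refine tsum_congr fun k => ?_
    push_cast
    linear_combination x ^ (k + 1) * coulombConst_mul_coeff (η := η) hl hl1 k

lemma hasDerivAt_coulombPhi_succ (hl : -3/2 < l) (hl1 : l ≠ -1) {x : ℝ} (hx : 0 < x) :
    HasDerivAt (coulombPhi (l + 1) η)
      (((2 * l + 3) * coulombPhi l η x -
        ((2 * l + 3) + η / (l + 1) * x) * coulombPhi (l + 1) η x) / x) x := by
  obtain ⟨M, hM⟩ := exists_abs_coulombCoeff_le η hl
  obtain ⟨N, hN⟩ := exists_abs_coulombCoeff_le (l := l + 1) η (by linarith)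
  have hphi := summable_mul_pow_of_abs_le hM x
  have hpsi := summable_mul_pow_of_abs_le hN x
  have hder := summable_succ_mul_pow_of_abs_le hN x
  refine (hasDerivAt_tsum_mul_pow hN x).congr_deriv ?_
  have hphi1 : Summable fun k => coulombCoeff l η (k + 1) * x ^ (k + 1) :=
    (summable_nat_add_iff 1).2 hphi
  have hpsi1 : Summable fun k => coulombCoeff (l + 1) η (k + 1) * x ^ (k + 1) :=
    (summable_nat_add_iff 1).2 hpsi
  rw [eq_div_iff hx.ne']
  have h1 : coulombPhi l η x = 1 + ∑' k, coulombCoeff l η (k + 1) * x ^ (k + 1) := by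
    rw [coulombPhi, hphi.tsum_eq_zero_add]; simp [coulombCoeff]
  have h2 : coulombPhi (l + 1) η x =
      1 + ∑' k, coulombCoeff (l + 1) η (k + 1) * x ^ (k + 1) := by
    rw [coulombPhi, hpsi.tsum_eq_zero_add]; simp [coulombCoeff]
  have hsum : (∑' k : ℕ, ((k : ℝ) + 1) * coulombCoeff (l + 1) η (k + 1) * x ^ k) * x =
      (2 * l + 3) * (∑' k, coulombCoeff l η (k + 1) * x ^ (k + 1)) -
        (2 * l + 3) * (∑' k, coulombCoeff (l + 1) η (k + 1) * x ^ (k + 1)) -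
        η / (l + 1) * x * coulombPhi (l + 1) η x := by
    rw [coulombPhi, ← tsum_mul_right, ← tsum_mul_left, ← tsum_mul_left, ← tsum_mul_left,
      ← (hphi1.mul_left _).tsum_sub (hpsi1.mul_left _),
      ← ((hphi1.mul_left _).sub (hpsi1.mul_left _)).tsum_sub (hpsi.mul_left _)]
    refine tsum_congr fun k => ?_
    linear_combination x ^ (k + 1) * coulombCoeff_succ_relation (η := η) hl hl1 k
  linear_combination hsum - (2 * l + 3) * h1 + (2 * l + 3) * h2

end Functions

section System

variable {f g : ℝ → ℝ} {α c d : ℝ}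

lemma exists_zero_right_of_system (hc : 0 < c)
    (hf : ∀ x, HasDerivAt f (α * f x - c * x * g x) x)
    {a b : ℝ} (ha : 0 < a) (hab : a < b) (hfa : f a = 0) (hfb : f b = 0) :
    ∃ x ∈ Ioo a b, g x = 0 := by
  have hexp : ∀ x, HasDerivAt (fun t => Real.exp (-α * t)) (Real.exp (-α * x) * (-α * 1)) x :=
    fun x => ((hasDerivAt_id x).const_mul (-α)).exp
  have hp : ∀ x, HasDerivAt (fun t => Real.exp (-α * t) * f t)
      (-(Real.exp (-α * x) * c * x) * g x) x := fun x =>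
    ((hexp x).mul (hf x)).congr_deriv (by ring)
  obtain ⟨x, hx, hx0⟩ := exists_hasDerivAt_eq_zero hab
    (fun x _ => (hp x).continuousAt.continuousWithinAt) (by simp [hfa, hfb]) fun x _ => hp x
  have hx' : 0 < x := ha.trans hx.1
  refine ⟨x, hx, (mul_eq_zero.1 hx0).resolve_left ?_⟩
  have := Real.exp_pos (-α * x)
  exact neg_ne_zero.2 (by positivity)

lemma exists_zero_left_of_system (hd : 0 < d) (hg0 : Continuous g)
    (hg : ∀ x, 0 < x → HasDerivAt g ((d * f x - (d + α * x) * g x) / x) x)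
    {a b : ℝ} (ha : a = 0 ∨ 0 < a ∧ g a = 0) (hab : a < b) (hgb : g b = 0) :
    ∃ x ∈ Ioo a b, f x = 0 := by
  have ha' : 0 ≤ a := ha.elim (fun h => h.ge) fun h => h.1.le
  have hq : ∀ x ∈ Ioo a b, HasDerivAt (fun t => t ^ d * Real.exp (α * t) * g t)
      (d * x ^ (d - 1) * Real.exp (α * x) * f x) x := fun x hx => by
    have hx' : 0 < x := ha'.trans_lt hx.1
    have hexp : HasDerivAt (fun t => Real.exp (α * t)) (Real.exp (α * x) * (α * 1)) x :=
      ((hasDerivAt_id x).const_mul α).exp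
    refine (((Real.hasDerivAt_rpow_const (p := d) (Or.inl hx'.ne')).mul hexp).mul
      (hg x hx')).congr_deriv ?_
    have hpow : x ^ d = x ^ (d - 1) * x := by
      rw [← Real.rpow_add_one hx'.ne', sub_add_cancel]
    simp only [Pi.mul_apply]
    rw [hpow]
    field_simp
    ring
  have hcont : Continuous fun t : ℝ => t ^ d * Real.exp (α * t) * g t :=
    ((Real.continuous_rpow_const hd.le).mul (by fun_prop)).mul hg0
  obtain ⟨x, hx, hx0⟩ := exists_hasDerivAt_eq_zero hab hcont.continuousOn
    (by rcases ha with rfl | ⟨_, h⟩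
        · simp [hgb, Real.zero_rpow hd.ne']
        · simp [h, hgb]) hq
  have hx' : 0 < x := ha'.trans_lt hx.1
  refine ⟨x, hx, (mul_eq_zero.1 hx0).resolve_left ?_⟩
  positivity

lemma not_common_zero_of_system (hc : 0 < c) (hd : 0 < d) (hf0 : f 0 ≠ 0)
    (hf : ∀ x, HasDerivAt f (α * f x - c * x * g x) x)
    (hg : ∀ x, 0 < x → HasDerivAt g ((d * f x - (d + α * x) * g x) / x) x)
    {x : ℝ} (hx : 0 < x) : ¬(f x = 0 ∧ g x = 0) := by
  rintro ⟨hfx, hgx⟩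
  set E : ℝ → ℝ := fun t => f t ^ 2 + c / d * t ^ 2 * g t ^ 2 with hE
  set W : ℝ → ℝ := fun t => t ^ (2 * d) * Real.exp (2 * |α| * t) * E t with hW
  have hEd : ∀ t, 0 < t → HasDerivAt E
      (2 * α * f t ^ 2 + (2 - 2 * d - 2 * α * t) * (c / d * t) * g t ^ 2) t := fun t ht => by
    refine (((hf t).pow 2).add ((((hasDerivAt_pow 2 t).const_mul (c / d))).mul
      ((hg t ht).pow 2))).congr_deriv ?_
    simp only [Pi.pow_apply]
    push_cast
    field_simp
    ring
  have hWd : ∀ t, 0 < t → HasDerivAt W (t ^ (2 * d - 1) * Real.exp (2 * |α| * t) *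
      ((2 * d + 2 * (|α| + α) * t) * f t ^ 2 +
        (2 + 2 * (|α| - α) * t) * (c / d * t ^ 2) * g t ^ 2)) t := fun t ht => by
    have hexp : HasDerivAt (fun t => Real.exp (2 * |α| * t))
        (Real.exp (2 * |α| * t) * (2 * |α| * 1)) t :=
      ((hasDerivAt_id t).const_mul (2 * |α|)).exp
    refine (((Real.hasDerivAt_rpow_const (p := 2 * d) (Or.inl ht.ne')).mul hexp).mul
      (hEd t ht)).congr_deriv ?_
    have hpow : t ^ (2 * d) = t ^ (2 * d - 1) * t := by
      rw [← Real.rpow_add_one ht.ne', sub_add_cancel]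
    simp only [hE, Pi.mul_apply]
    rw [hpow]
    field_simp
    ring
  have hmono : MonotoneOn W (Ioi 0) := by
    refine monotoneOn_of_deriv_nonneg (convex_Ioi 0)
      (fun t ht => (hWd t ht).continuousAt.continuousWithinAt)
      (fun t ht => (hWd t (interior_subset ht)).differentiableAt.differentiableWithinAt)
      fun t ht => ?_
    have ht' : 0 < t := interior_subset ht
    rw [(hWd t ht').deriv]
    have h1 : 0 ≤ |α| + α := by linarith [neg_abs_le α]
    have h2 : 0 ≤ |α| - α := by linarith [le_abs_self α]
    positivity
  have hzero : ∀ t ∈ Ioo 0 x, f t = 0 := fun t ht => by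
    have ht' : 0 < t := ht.1
    have h1 : W t ≤ W x := hmono ht.1 hx ht.2.le
    have h2 : W x = 0 := by simp [hW, hE, hfx, hgx]
    have h3 : E t ≤ 0 := by
      by_contra! h
      have : 0 < W t := by simp only [hW]; positivity
      linarith
    have h4 : 0 ≤ c / d * t ^ 2 * g t ^ 2 := by positivity
    have h5 : f t ^ 2 ≤ 0 := by simp only [hE] at h3; linarith
    exact pow_eq_zero_iff two_ne_zero |>.1 (le_antisymm h5 (sq_nonneg _))
  have hlim : Tendsto f (𝓝[>] 0) (𝓝 (f 0)) :=
    (hf 0).continuousAt.tendsto.mono_left nhdsWithin_le_nhds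
  refine hf0 (tendsto_nhds_unique hlim (tendsto_const_nhds.congr' ?_))
  filter_upwards [Ioo_mem_nhdsGT hx] with t ht using (hzero t ht).symm

/-- Sturm comparison with `sin ((t - X) / 2)`. -/
lemma not_forall_pos_of_system {m X : ℝ} (hcd : c * d = α ^ 2 + 1) (hdm : d = 2 * m + 1)
    (hX1 : 1 ≤ X) (hX : 2 * (|2 * α * m| + |m - m ^ 2|) ≤ X)
    (hf : ∀ x, HasDerivAt f (α * f x - c * x * g x) x)
    (hg : ∀ x, 0 < x → HasDerivAt g ((d * f x - (d + α * x) * g x) / x) x)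
    (hpos : ∀ x, X ≤ x → 0 < f x) : False := by
  set W : ℝ → ℝ := fun t => t ^ m * (f t * (Real.cos ((t - X) / 2) / 2) -
    (α * f t - c * t * g t + m * f t / t) * Real.sin ((t - X) / 2)) with hW
  have hWd : ∀ t, 0 < t → HasDerivAt W (t ^ m * f t * Real.sin ((t - X) / 2) *
      (3 / 4 - 2 * α * m / t + (m - m ^ 2) / t ^ 2)) t := fun t ht => by
    have hlin : HasDerivAt (fun t => (t - X) / 2) (1 / 2) t :=
      ((hasDerivAt_id t).sub_const X).div_const 2
    have hcg := ((hasDerivAt_id t).const_mul c).mul (hg t ht)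
    have hq := ((hf t).const_mul m).div (hasDerivAt_id t) ht.ne'
    refine ((Real.hasDerivAt_rpow_const (p := m) (Or.inl ht.ne')).mul
      (((hf t).mul (hlin.cos.div_const 2)).sub
        ((((hf t).const_mul α).sub hcg).add hq |>.mul hlin.sin))).congr_deriv ?_
    have hpow : t ^ m = t ^ (m - 1) * t := by
      rw [← Real.rpow_add_one ht.ne', sub_add_cancel]
    simp only [id, Pi.mul_apply, Pi.sub_apply, Pi.add_apply, Pi.div_apply]
    rw [hpow]
    field_simp
    linear_combination 16 * t ^ 2 * Real.sin ((t - X) / 2) * (f t * hcd - c * g t * hdm)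
  have hπ := Real.pi_pos
  have hmono : MonotoneOn W (Icc X (X + 2 * Real.pi)) := by
    have hI : ∀ t ∈ Icc X (X + 2 * Real.pi), 0 < t := fun t ht => by linarith [ht.1]
    refine monotoneOn_of_deriv_nonneg (convex_Icc _ _)
      (fun t ht => (hWd t (hI t ht)).continuousAt.continuousWithinAt)
      (fun t ht => (hWd t (hI t (interior_subset ht))).differentiableAt.differentiableWithinAt)
      fun t ht => ?_
    have ht' := interior_subset ht
    have ht0 := hI t ht'
    have ht1 : 1 ≤ t := hX1.trans ht'.1
    rw [(hWd t ht0).deriv]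
    have hsin : 0 ≤ Real.sin ((t - X) / 2) :=
      Real.sin_nonneg_of_nonneg_of_le_pi (by linarith [ht'.1]) (by linarith [ht'.2])
    have hft := hpos t ht'.1
    have hQ : 0 ≤ 3 / 4 - 2 * α * m / t + (m - m ^ 2) / t ^ 2 := by
      have h1 : 2 * α * m / t ≤ |2 * α * m| / t := by gcongr; exact le_abs_self _
      have h2 : -(|m - m ^ 2| / t) ≤ (m - m ^ 2) / t ^ 2 := by
        rw [neg_le, ← neg_div]
        calc -(m - m ^ 2) / t ^ 2 ≤ |m - m ^ 2| / t ^ 2 := by gcongr; exact neg_le_abs _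
          _ ≤ |m - m ^ 2| / t := by gcongr; nlinarith
      have h3 : (|2 * α * m| + |m - m ^ 2|) / t ≤ 1 / 2 := by
        rw [div_le_iff₀ ht0]; linarith [ht'.1]
      rw [add_div] at h3
      linarith
    positivity
  have hle := hmono (left_mem_Icc.2 (by linarith)) (right_mem_Icc.2 (by linarith))
    (by linarith : X ≤ X + 2 * Real.pi)
  have hXpos : 0 < X := by linarith
  have hX2 : 0 < X + 2 * Real.pi := by linarith
  have h1 := hpos X le_rfl
  have h2 := hpos (X + 2 * Real.pi) (by linarith)
  have e1 : W X = X ^ m * (f X / 2) := by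
    simp only [hW, sub_self, zero_div, Real.cos_zero, Real.sin_zero]
    ring
  have e2 : W (X + 2 * Real.pi) = -((X + 2 * Real.pi) ^ m * (f (X + 2 * Real.pi) / 2)) := by
    simp only [hW]
    rw [show (X + 2 * Real.pi - X) / 2 = Real.pi by ring, Real.cos_pi, Real.sin_pi]
    ring
  have h3 : 0 < W X := by rw [e1]; positivity
  have h4 : 0 < (X + 2 * Real.pi) ^ m * (f (X + 2 * Real.pi) / 2) := by positivity
  linarith

lemma exists_zero_gt_of_system {m : ℝ} (hcd : c * d = α ^ 2 + 1) (hdm : d = 2 * m + 1)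
    (hf : ∀ x, HasDerivAt f (α * f x - c * x * g x) x)
    (hg : ∀ x, 0 < x → HasDerivAt g ((d * f x - (d + α * x) * g x) / x) x) (Y : ℝ) :
    ∃ x, Y < x ∧ f x = 0 := by
  by_contra! hne
  obtain ⟨X, hXY, hX1, hX⟩ : ∃ X, Y < X ∧ 1 ≤ X ∧ 2 * (|2 * α * m| + |m - m ^ 2|) ≤ X :=
    ⟨max (Y + 1) (max 1 (2 * (|2 * α * m| + |m - m ^ 2|))),
      (lt_add_one Y).trans_le (le_max_left _ _), (le_max_left _ _).trans (le_max_right _ _),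
      (le_max_right _ _).trans (le_max_right _ _)⟩
  have hcont : Continuous f := continuous_iff_continuousAt.2 fun x => (hf x).continuousAt
  rcases lt_or_gt_of_ne (hne X hXY) with hneg | hpos
  · refine not_forall_pos_of_system (f := fun x => -f x) (g := fun x => -g x) hcd hdm hX1 hX
      (fun x => (hf x).neg.congr_deriv (by ring))
      (fun x hx => (hg x hx).neg.congr_deriv (by ring)) fun x hx => ?_
    by_contra! h
    obtain ⟨y, hy, hy0⟩ := intermediate_value_Icc hx hcont.continuousOn
      ⟨hneg.le, by linarith⟩
    exact hne y (hXY.trans_le hy.1) hy0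
  · refine not_forall_pos_of_system hcd hdm hX1 hX hf hg fun x hx => ?_
    by_contra! h
    obtain ⟨y, hy, hy0⟩ := intermediate_value_Icc' hx hcont.continuousOn ⟨h, hpos.le⟩
    exact hne y (hXY.trans_le hy.1) hy0

end System

section Zeros

lemma exists_isPosZeroEnum {f : ℝ → ℝ} (hf : Continuous f) (hf0 : f 0 ≠ 0)
    (hsimple : ∀ x, 0 < x → f x = 0 → ∃ f', f' ≠ 0 ∧ HasDerivAt f f' x)
    (hunb : ∀ X, ∃ x, X < x ∧ f x = 0) : ∃ ρ, IsPosZeroEnum f ρ := by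
  set S : Set ℝ := {x | 0 < x ∧ f x = 0} with hS
  have hfin : ∀ b, (S ∩ Iic b).Finite := fun b => by
    by_contra hinf
    obtain ⟨x, hx, hacc⟩ := Set.Infinite.exists_accPt_of_subset_isCompact hinf
      (isCompact_Icc (a := 0) (b := b)) fun y hy => ⟨hy.1.1.le, hy.2⟩
    have hfreq : ∃ᶠ y in 𝓝[≠] x, f y = 0 :=
      (accPt_iff_frequently_nhdsNE.1 hacc).mono fun y hy => hy.1.2
    have hfx : f x = 0 :=
      (isClosed_singleton.preimage hf).mem_of_frequently_of_tendsto hfreq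
        (tendsto_id.mono_left nhdsWithin_le_nhds)
    have hx0 : 0 < x := hx.1.lt_of_ne fun h => hf0 (h ▸ hfx)
    obtain ⟨f', hf', hd⟩ := hsimple x hx0 hfx
    exact hfreq (hd.eventually_ne hf')
  have hfin' : ∀ b : S, (Iic b).Finite := fun b =>
    ((hfin b).preimage Subtype.val_injective.injOn).subset fun y hy => ⟨y.2, hy⟩
  obtain ⟨x₀, hx₀, hfx₀⟩ := hunb 0
  have : Nonempty S := ⟨⟨x₀, hx₀, hfx₀⟩⟩
  have : NoMaxOrder S := ⟨fun a => by
    obtain ⟨x, hx, hfx⟩ := hunb a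
    exact ⟨⟨x, a.2.1.trans hx, hfx⟩, hx⟩⟩
  obtain ⟨b, hb⟩ : ∃ b : S, ∀ y, b ≤ y := by
    obtain ⟨b, -, hb⟩ := Set.exists_min_image _ id (hfin' ⟨x₀, hx₀, hfx₀⟩) ⟨_, self_mem_Iic⟩
    refine ⟨b, fun y => ?_⟩
    rcases le_total y ⟨x₀, hx₀, hfx₀⟩ with h | h
    · exact hb y h
    · exact (hb _ self_mem_Iic).trans h
  let : OrderBot S := { bot := b, bot_le := hb }
  let : LocallyFiniteOrder S :=
    LocallyFiniteOrder.ofFiniteIcc fun a b => (hfin' b).subset Icc_subset_Iic_self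
  let : SuccOrder S := LinearLocallyFiniteOrder.succOrder S
  let : PredOrder S := LinearLocallyFiniteOrder.predOrder S
  let e : S ≃o ℕ := orderIsoNatOfLinearSuccPredArch
  refine ⟨fun k => (e.symm k : S), fun i j hij => e.symm.strictMono hij,
    fun k => (e.symm k).2, fun x hx hfx => ⟨e ⟨x, hx, hfx⟩, ?_⟩⟩
  simp

lemma IsPosZeroEnum.interlace {f g : ℝ → ℝ} {ρ σ : ℕ → ℝ} (hρ : IsPosZeroEnum f ρ)
    (hσ : IsPosZeroEnum g σ)
    (hfg : ∀ a b, 0 < a → a < b → f a = 0 → f b = 0 → ∃ x ∈ Ioo a b, g x = 0)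
    (hgf : ∀ a b, (a = 0 ∨ 0 < a ∧ g a = 0) → a < b → g b = 0 → ∃ x ∈ Ioo a b, f x = 0)
    (k : ℕ) : ρ k < σ k ∧ σ k < ρ (k + 1) := by
  have hB : ∀ k, ∃ j, ρ k < σ j ∧ σ j < ρ (k + 1) := fun k => by
    obtain ⟨x, hx, hgx⟩ := hfg _ _ (hρ.2.1 k).1 (hρ.1 k.lt_succ_self) (hρ.2.1 k).2
      (hρ.2.1 (k + 1)).2
    obtain ⟨j, rfl⟩ := hσ.2.2 x ((hρ.2.1 k).1.trans hx.1) hgx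
    exact ⟨j, hx⟩
  have hC : ∀ k, ∃ j, σ k < ρ j ∧ ρ j < σ (k + 1) := fun k => by
    obtain ⟨x, hx, hfx⟩ := hgf _ _ (Or.inr (hσ.2.1 k)) (hσ.1 k.lt_succ_self) (hσ.2.1 (k + 1)).2
    obtain ⟨j, rfl⟩ := hρ.2.2 x ((hσ.2.1 k).1.trans hx.1) hfx
    exact ⟨j, hx⟩
  have hA : ρ 0 < σ 0 := by
    obtain ⟨x, hx, hfx⟩ := hgf 0 _ (Or.inl rfl) (hσ.2.1 0).1 (hσ.2.1 0).2
    obtain ⟨j, rfl⟩ := hρ.2.2 x hx.1 hfx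
    exact (hρ.1.monotone j.zero_le).trans_lt hx.2
  induction k with
  | zero =>
    obtain ⟨j, hj⟩ := hB 0
    exact ⟨hA, (hσ.1.monotone j.zero_le).trans_lt hj.2⟩
  | succ k ih =>
    have h1 : ρ (k + 1) < σ (k + 1) := by
      obtain ⟨j, hj⟩ := hC k
      have : k < j := hρ.1.lt_iff_lt.1 (ih.1.trans hj.1)
      exact (hρ.1.monotone this).trans_lt hj.2
    obtain ⟨j, hj⟩ := hB (k + 1)
    have : k < j := hσ.1.lt_iff_lt.1 (ih.2.trans hj.1)
    exact ⟨h1, (hσ.1.monotone this).trans_lt hj.2⟩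

end Zeros

/-- Theorem 3.1: for ℓ > −3/2, ℓ ≠ −1, η ≠ 0, the functions φ_{ℓ,η} and φ_{ℓ+1,η} have
infinitely many positive zeros, all simple, none in common, and their positive zeros
interlace as 0 < ρ_{ℓ,η,1} < ρ_{ℓ+1,η,1} < ρ_{ℓ,η,2} < ρ_{ℓ+1,η,2} < ⋯ . -/
theorem stmt_4 (l η : ℝ) (hl : -3/2 < l) (hl1 : l ≠ -1) (hη : η ≠ 0)
    (hl2 : ∀ n : ℕ, 2 * l + 2 ≠ -(n : ℝ)) :
    ∃ ρ₁ ρ₂ : ℕ → ℝ,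
      IsPosZeroEnum (coulombPhi l η) ρ₁ ∧ IsPosZeroEnum (coulombPhi (l + 1) η) ρ₂ ∧
        (∀ k, deriv (coulombPhi l η) (ρ₁ k) ≠ 0) ∧
        (∀ k, deriv (coulombPhi (l + 1) η) (ρ₂ k) ≠ 0) ∧
        (∀ x : ℝ, 0 < x → ¬(coulombPhi l η x = 0 ∧ coulombPhi (l + 1) η x = 0)) ∧
        ∀ k, ρ₁ k < ρ₂ k ∧ ρ₂ k < ρ₁ (k + 1) := by
  have hd : 0 < 2 * l + 3 := by linarith
  have hc := coulombConst_pos (η := η) hl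
  have hf := hasDerivAt_coulombPhi (η := η) hl hl1
  have hg := fun x (hx : 0 < x) => hasDerivAt_coulombPhi_succ (η := η) hl hl1 hx
  have hcont1 : Continuous (coulombPhi l η) :=
    continuous_iff_continuousAt.2 fun x => (hf x).continuousAt
  have hcont2 : Continuous (coulombPhi (l + 1) η) :=
    continuous_iff_continuousAt.2 fun x => (hasDerivAt_coulombPhi (by linarith)
      (by intro h; linarith) x).continuousAt
  have hnot : ∀ x : ℝ, 0 < x → ¬(coulombPhi l η x = 0 ∧ coulombPhi (l + 1) η x = 0) :=
    fun x => not_common_zero_of_system hc hd (by simp [coulombPhi_zero]) hf hg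
  have hfg := fun a b => exists_zero_right_of_system hc hf (a := a) (b := b)
  have hgf := fun a b => exists_zero_left_of_system hd hcont2 hg (a := a) (b := b)
  have hunb1 := exists_zero_gt_of_system (m := l + 1) (coulombConst_mul hl) (by ring) hf hg
  have hunb2 : ∀ X, ∃ x, X < x ∧ coulombPhi (l + 1) η x = 0 := fun X => by
    obtain ⟨a, ha, hfa⟩ := hunb1 (max X 0)
    obtain ⟨b, hb, hfb⟩ := hunb1 a
    obtain ⟨x, hx, hgx⟩ := hfg a b ((le_max_right _ _).trans_lt ha) hb hfa hfb
    exact ⟨x, ((le_max_left _ _).trans_lt ha).trans hx.1, hgx⟩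
  have hder1 : ∀ x, 0 < x → coulombPhi l η x = 0 → η / (l + 1) * coulombPhi l η x -
      coulombConst l η * x * coulombPhi (l + 1) η x ≠ 0 := fun x hx h => by
    have : coulombPhi (l + 1) η x ≠ 0 := fun h' => hnot x hx ⟨h, h'⟩
    rw [h, mul_zero, zero_sub]
    exact neg_ne_zero.2 (mul_ne_zero (mul_pos hc hx).ne' this)
  have hder2 : ∀ x, 0 < x → coulombPhi (l + 1) η x = 0 → ((2 * l + 3) * coulombPhi l η x -
      ((2 * l + 3) + η / (l + 1) * x) * coulombPhi (l + 1) η x) / x ≠ 0 := fun x hx h => by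
    have : coulombPhi l η x ≠ 0 := fun h' => hnot x hx ⟨h', h⟩
    rw [h, mul_zero, sub_zero]
    exact div_ne_zero (mul_ne_zero hd.ne' this) hx.ne'
  obtain ⟨ρ₁, h₁⟩ := exists_isPosZeroEnum hcont1 (by simp [coulombPhi_zero])
    (fun x hx h => ⟨_, hder1 x hx h, hf x⟩) hunb1
  obtain ⟨ρ₂, h₂⟩ := exists_isPosZeroEnum hcont2 (by simp [coulombPhi_zero])
    (fun x hx h => ⟨_, hder2 x hx h, hg x hx⟩) hunb2
  refine ⟨ρ₁, ρ₂, h₁, h₂, fun k => ?_, fun k => ?_, hnot, h₁.interlace h₂ hfg hgf⟩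
  · rw [(hf _).deriv]
    exact hder1 _ (h₁.2.1 k).1 (h₁.2.1 k).2
  · rw [(hg _ (h₂.2.1 k).1).deriv]
    exact hder2 _ (h₂.2.1 k).1 (h₂.2.1 k).2
end

section
/- Fix η ∈ ℝ and k ∈ ℕ. Then the k-th positive zero of the regular Coulomb wave function is strictly increasing in ℓ on (−1/2, ∞): if −1/2 < ℓ₁ < ℓ₂, then ρ_{ℓ₁,η,k} < ρ_{ℓ₂,η,k}. -/
theorem summable_mul_pow_of_le_factorial {c : ℕ → ℝ} {C M : ℝ}
    (hc : ∀ k, |c k| ≤ C * (M ^ k / k.factorial)) (x : ℝ) :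
    Summable fun k => c k * x ^ k := by
  refine Summable.of_norm_bounded
    (g := fun k : ℕ => C * ((M * |x|) ^ k / k.factorial))
    ((Real.summable_pow_div_factorial (M * |x|)).mul_left C) fun k => ?_
  rw [Real.norm_eq_abs, abs_mul, abs_pow]
  calc |c k| * |x| ^ k ≤ C * (M ^ k / k.factorial) * |x| ^ k := by gcongr; exact hc k
    _ = _ := by rw [mul_pow]; ring

theorem abs_succ_mul_le_factorial {c : ℕ → ℝ} {C M : ℝ}
    (hc : ∀ k, |c k| ≤ C * (M ^ k / k.factorial)) (k : ℕ) :
    |((k : ℝ) + 1) * c (k + 1)| ≤ C * M * (M ^ k / k.factorial) := by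
  have hk : (0 : ℝ) < (k : ℝ) + 1 := by positivity
  have hf : (0 : ℝ) < (k.factorial : ℝ) := by positivity
  rw [abs_mul, abs_of_pos hk]
  calc ((k : ℝ) + 1) * |c (k + 1)|
      ≤ ((k : ℝ) + 1) * (C * (M ^ (k + 1) / (k + 1).factorial)) := by gcongr; exact hc (k + 1)
    _ = _ := by
      rw [Nat.factorial_succ]
      push_cast
      field_simp
      ring

/-- A power series with coefficients bounded by `C * M ^ k / k!` may be differentiated termwise. -/
theorem hasDerivAt_tsum_mul_pow_of_le_factorial {c : ℕ → ℝ} {C M : ℝ}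
    (hc : ∀ k, |c k| ≤ C * (M ^ k / k.factorial)) (x : ℝ) :
    HasDerivAt (fun y => ∑' k, c k * y ^ k) (∑' k : ℕ, ((k : ℝ) + 1) * c (k + 1) * x ^ k) x := by
  have hd := abs_succ_mul_le_factorial hc
  set R : ℝ := |x| + 1
  have hsum : Summable fun k : ℕ => |c k| * (k * R ^ (k - 1)) := by
    rw [← summable_nat_add_iff 1]
    have h := summable_mul_pow_of_le_factorial
      (c := fun k : ℕ => |((k : ℝ) + 1) * c (k + 1)|) (by simpa only [abs_abs] using hd) R
    refine h.congr fun k => ?_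
    have hk : (0 : ℝ) < (k : ℝ) + 1 := by positivity
    rw [abs_mul, abs_of_pos hk]
    simp only [Nat.add_sub_cancel]
    push_cast
    ring
  have key := hasDerivAt_tsum_of_isPreconnected (t := Metric.ball (0 : ℝ) R) (y₀ := 0) (y := x)
    (g := fun k y => c k * y ^ k) (g' := fun k y => c k * (k * y ^ (k - 1)))
    hsum Metric.isOpen_ball (convex_ball _ _).isPreconnected
    (fun k y _ => (hasDerivAt_pow k y).const_mul (c k))
    (fun k y hy => by
      have hy' : |y| ≤ R := by simpa using (Metric.mem_ball.1 hy).le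
      rw [Real.norm_eq_abs, abs_mul, abs_mul, abs_pow, Nat.abs_cast]
      gcongr)
    (Metric.mem_ball_self (by positivity))
    (summable_mul_pow_of_le_factorial hc 0)
    (by simp [R])
  have hs : Summable fun k : ℕ => c k * (k * x ^ (k - 1)) := by
    rw [← summable_nat_add_iff 1]
    refine (summable_mul_pow_of_le_factorial hd x).congr fun k => ?_
    simp only [Nat.add_sub_cancel]
    push_cast
    ring
  refine key.congr_deriv ?_
  rw [hs.tsum_eq_zero_add]
  simp only [Nat.cast_zero, zero_mul, mul_zero, zero_add]
  refine tsum_congr fun k => ?_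
  simp only [Nat.add_sub_cancel]
  push_cast
  ring

theorem abs_coulombCoeff_le {l : ℝ} (hl : -1 / 2 < l) (η : ℝ) (k : ℕ) :
    |coulombCoeff l η k| ≤ 1 * ((2 * |η| + 2) ^ k / k.factorial) := by
  rw [one_mul]
  set M : ℝ := 2 * |η| + 2 with hM
  have hη : 0 ≤ |η| := abs_nonneg η
  induction k using Nat.twoStepInduction with
  | zero => simp [coulombCoeff]
  | one =>
    have h : 0 < l + 1 := by linarith
    simp only [coulombCoeff, pow_one, Nat.factorial_one, Nat.cast_one, div_one]
    rw [abs_div, abs_of_pos h, div_le_iff₀ h, hM]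
    nlinarith
  | more k ih₀ ih₁ =>
    have hk : (0 : ℝ) ≤ k := k.cast_nonneg
    have hf : (0 : ℝ) < (k.factorial : ℝ) := by positivity
    have hden : 0 < ((k : ℝ) + 2) * ((k : ℝ) + 2 + 2 * l + 1) := by
      apply mul_pos <;> linarith
    have hMk : 0 < M ^ k := by positivity
    rw [coulombCoeff, abs_div, abs_of_pos hden, div_le_iff₀ hden]
    have hnum : |2 * η * coulombCoeff l η (k + 1) - coulombCoeff l η k| ≤
        2 * |η| * (M ^ (k + 1) / (k + 1).factorial) + M ^ k / k.factorial := by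
      refine (abs_sub _ _).trans (add_le_add ?_ ih₀)
      rw [abs_mul, abs_mul, abs_two]
      exact mul_le_mul_of_nonneg_left ih₁ (by positivity)
    refine hnum.trans ?_
    have hle : ((k : ℝ) + 2) * ((k : ℝ) + 2) ≤ ((k : ℝ) + 2) * ((k : ℝ) + 2 + 2 * l + 1) :=
      mul_le_mul_of_nonneg_left (by linarith) (by positivity)
    refine le_trans ?_ (mul_le_mul_of_nonneg_left hle (by positivity))
    have e₁ : ((k + 1).factorial : ℝ) = ((k : ℝ) + 1) * k.factorial := by
      rw [Nat.factorial_succ]; push_cast; ring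
    have e₂ : ((k + 2).factorial : ℝ) = ((k : ℝ) + 2) * (((k : ℝ) + 1) * k.factorial) := by
      rw [Nat.factorial_succ, e₁.symm]; push_cast; ring
    rw [e₁, e₂]
    have lhs : 2 * |η| * (M ^ (k + 1) / (((k : ℝ) + 1) * k.factorial)) + M ^ k / k.factorial =
        M ^ k / (((k : ℝ) + 1) * k.factorial) * (2 * |η| * M + (k + 1)) := by
      field_simp
      ring
    have rhs : M ^ (k + 2) / (((k : ℝ) + 2) * (((k : ℝ) + 1) * k.factorial)) *
        (((k : ℝ) + 2) * ((k : ℝ) + 2)) =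
        M ^ k / (((k : ℝ) + 1) * k.factorial) * (M ^ 2 * (k + 2)) := by
      rw [pow_add]
      field_simp
    rw [lhs, rhs]
    refine mul_le_mul_of_nonneg_left ?_ (by positivity)
    nlinarith [mul_nonneg hη hk, mul_nonneg hη hη, mul_nonneg (mul_nonneg hη hη) hk]

/-- `φ_{ℓ,η}` is a solution of `x φ'' + (2ℓ + 2) φ' + (x - 2η) φ = 0`. -/
theorem exists_hasDerivAt_coulombPhi {l : ℝ} (hl : -1 / 2 < l) (η : ℝ) :
    ∃ d dd : ℝ → ℝ, (∀ x, HasDerivAt (coulombPhi l η) (d x) x) ∧ (∀ x, HasDerivAt d (dd x) x) ∧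
      ∀ x, x * dd x + (2 * l + 2) * d x + (x - 2 * η) * coulombPhi l η x = 0 := by
  have b₀ := abs_coulombCoeff_le hl η
  have b₁ := abs_succ_mul_le_factorial b₀
  have b₂ := abs_succ_mul_le_factorial b₁
  refine ⟨_, _, hasDerivAt_tsum_mul_pow_of_le_factorial b₀,
    hasDerivAt_tsum_mul_pow_of_le_factorial b₁, fun x => ?_⟩
  have s₀ := summable_mul_pow_of_le_factorial b₀ x
  have s₁ := summable_mul_pow_of_le_factorial b₁ x
  have s₂ := summable_mul_pow_of_le_factorial b₂ x
  have t₀ : Summable fun k : ℕ => coulombCoeff l η (k + 1) * x ^ k := by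
    refine summable_mul_pow_of_le_factorial (C := 1 * (2 * |η| + 2))
      (M := 2 * |η| + 2) (fun k => ?_) x
    refine le_trans ?_ (b₁ k)
    rw [abs_mul]
    refine le_mul_of_one_le_left (abs_nonneg _) ?_
    rw [abs_of_pos (by positivity)]
    linarith [k.cast_nonneg (α := ℝ)]
  have t₁ : Summable fun k : ℕ => ((k : ℝ) + 2) * coulombCoeff l η (k + 2) * x ^ k := by
    refine summable_mul_pow_of_le_factorial (C := 1 * (2 * |η| + 2) * (2 * |η| + 2))
      (M := 2 * |η| + 2) (fun k => ?_) x
    refine le_trans ?_ (b₂ k)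
    rw [abs_mul ((k : ℝ) + 1)]
    push_cast
    rw [show (k : ℝ) + 1 + 1 = k + 2 by ring]
    refine le_mul_of_one_le_left (abs_nonneg _) ?_
    rw [abs_of_pos (by positivity)]
    linarith [k.cast_nonneg (α := ℝ)]
  have e₀ : coulombPhi l η x = 1 + x * ∑' k : ℕ, coulombCoeff l η (k + 1) * x ^ k := by
    rw [coulombPhi, s₀.tsum_eq_zero_add, ← tsum_mul_left]
    congr 1
    · simp [coulombCoeff]
    · exact tsum_congr fun k => by ring
  have e₁ : (∑' k : ℕ, ((k : ℝ) + 1) * coulombCoeff l η (k + 1) * x ^ k) =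
      η / (l + 1) + x * ∑' k : ℕ, ((k : ℝ) + 2) * coulombCoeff l η (k + 2) * x ^ k := by
    rw [s₁.tsum_eq_zero_add, ← tsum_mul_left]
    congr 1
    · simp [coulombCoeff]
    · exact tsum_congr fun k => by push_cast; ring
  have hrec := ((s₂.hasSum.add (t₁.hasSum.mul_left (2 * l + 2))).add s₀.hasSum).sub
    (t₀.hasSum.mul_left (2 * η))
  have hterm : (fun k : ℕ =>
      ((k : ℝ) + 1) * ((((k + 1 : ℕ) : ℝ) + 1) * coulombCoeff l η (k + 1 + 1)) * x ^ k +
        (2 * l + 2) * (((k : ℝ) + 2) * coulombCoeff l η (k + 2) * x ^ k) +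
        coulombCoeff l η k * x ^ k - 2 * η * (coulombCoeff l η (k + 1) * x ^ k)) =
      fun _ => 0 := by
    funext k
    have hk : (0 : ℝ) ≤ k := k.cast_nonneg
    have hden : ((k : ℝ) + 2) * ((k : ℝ) + 2 + 2 * l + 1) ≠ 0 := by
      apply mul_ne_zero <;> linarith
    have hc : coulombCoeff l η (k + 2) * (((k : ℝ) + 2) * ((k : ℝ) + 2 + 2 * l + 1)) =
        2 * η * coulombCoeff l η (k + 1) - coulombCoeff l η k := by
      rw [coulombCoeff, div_mul_cancel₀ _ hden]
    push_cast
    linear_combination x ^ k * hc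
  rw [hterm] at hrec
  have hzero := hrec.unique hasSum_zero
  rw [show (∑' k : ℕ, coulombCoeff l η k * x ^ k) = coulombPhi l η x from rfl] at hzero
  have h1 : (2 * l + 2) * (η / (l + 1)) = 2 * η := by
    have : l + 1 ≠ 0 := by linarith
    field_simp
  have h2 : (x - 2 * η) * coulombPhi l η x = x * coulombPhi l η x - 2 * η *
      (1 + x * ∑' k : ℕ, coulombCoeff l η (k + 1) * x ^ k) := by rw [← e₀]; ring
  rw [e₁, h2]
  linear_combination x * hzero + h1

/-- A function which is positive to the left of one of its zeros has nonpositive derivative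
there. -/
theorem HasDerivAt.nonpos_of_zero_of_pos_left {g : ℝ → ℝ} {g' a b : ℝ} (hab : a < b)
    (hg : HasDerivAt g g' b) (hb : g b = 0) (hpos : ∀ x ∈ Set.Ioo a b, 0 < g x) : g' ≤ 0 := by
  have h := (hasDerivWithinAt_iff_tendsto_slope' (s := Set.Iio b) (by simp)).1
    hg.hasDerivWithinAt
  refine le_of_tendsto h ?_
  filter_upwards [Ioo_mem_nhdsLT hab] with x hx
  rw [slope_def_field, hb, sub_zero]
  exact div_nonpos_of_nonneg_of_nonpos (hpos x hx).le (sub_nonpos.2 hx.2.le)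

/-- The Sturm comparison argument for two solutions of the equations satisfied by `φ_{ℓ₁,η}` and
`φ_{ℓ₂,η}`: their product cannot be positive between two consecutive zeros of the second one,
nor between `0` and its first positive zero. -/
theorem not_forall_mul_pos_of_coulomb_ode {η l₁ l₂ a b : ℝ} {f₁ d₁ dd₁ f₂ d₂ dd₂ : ℝ → ℝ}
    (h₁ : -1 / 2 < l₁) (h₂ : l₁ < l₂)
    (hf₁ : ∀ x, HasDerivAt f₁ (d₁ x) x) (hd₁ : ∀ x, HasDerivAt d₁ (dd₁ x) x)
    (ode₁ : ∀ x, x * dd₁ x + (2 * l₁ + 2) * d₁ x + (x - 2 * η) * f₁ x = 0)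
    (hf₂ : ∀ x, HasDerivAt f₂ (d₂ x) x) (hd₂ : ∀ x, HasDerivAt d₂ (dd₂ x) x)
    (ode₂ : ∀ x, x * dd₂ x + (2 * l₂ + 2) * d₂ x + (x - 2 * η) * f₂ x = 0)
    (ha0 : 0 ≤ a) (hab : a < b) (ha : a = 0 ∨ f₂ a = 0) (hb : f₂ b = 0) :
    ¬ ∀ x ∈ Set.Ioo a b, 0 < f₁ x * f₂ x := by
  intro hpos
  have hp : 0 < l₁ + l₂ + 1 := by linarith
  set p := l₁ + l₂ + 1 with hpdef
  set V : ℝ → ℝ := fun x => x * (d₁ x * f₂ x - f₁ x * d₂ x) + (l₁ - l₂) * (f₁ x * f₂ x) with hV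
  set W : ℝ → ℝ := fun x => x ^ p * V x with hW
  have hg : ∀ x, HasDerivAt (fun y => f₁ y * f₂ y) (d₁ x * f₂ x + f₁ x * d₂ x) x :=
    fun x => (hf₁ x).mul (hf₂ x)
  have hVd : ∀ x, HasDerivAt V (1 * (d₁ x * f₂ x - f₁ x * d₂ x) +
      x * ((dd₁ x * f₂ x + d₁ x * d₂ x) - (d₁ x * d₂ x + f₁ x * dd₂ x)) +
      (l₁ - l₂) * (d₁ x * f₂ x + f₁ x * d₂ x)) x := fun x =>
    ((hasDerivAt_id' x).mul (((hd₁ x).mul (hf₂ x)).sub ((hf₁ x).mul (hd₂ x)))).add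
      ((hg x).const_mul _)
  have hWc : Continuous W :=
    (Real.continuous_rpow_const hp.le).mul
      (continuous_iff_continuousAt.2 fun x => (hVd x).continuousAt)
  have hWd : ∀ x, 0 < x →
      HasDerivAt W (x ^ (p - 1) * ((l₁ - l₂) * p * (f₁ x * f₂ x))) x := by
    intro x hx
    have h := (Real.hasDerivAt_rpow_const (p := p) (Or.inl hx.ne')).mul (hVd x)
    refine h.congr_deriv ?_
    have hxp : x ^ p = x ^ (p - 1) * x := by
      rw [← Real.rpow_add_one hx.ne', sub_add_cancel]
    rw [hxp]
    simp only [hV, hpdef]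
    linear_combination (x ^ (l₁ + l₂ + 1 - 1) * x * f₂ x) * ode₁ x -
      (x ^ (l₁ + l₂ + 1 - 1) * x * f₁ x) * ode₂ x
  have hanti : StrictAntiOn W (Set.Icc a b) := by
    refine strictAntiOn_of_deriv_neg (convex_Icc a b) hWc.continuousOn fun x hx => ?_
    rw [interior_Icc] at hx
    have hx0 : 0 < x := ha0.trans_lt hx.1
    rw [(hWd x hx0).deriv]
    have := mul_pos (mul_pos (sub_pos.2 h₂) hp) (hpos x hx)
    have hr := Real.rpow_pos_of_pos hx0 (p - 1)
    nlinarith [mul_pos hr this]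
  have hlt := hanti (Set.left_mem_Icc.2 hab.le) (Set.right_mem_Icc.2 hab.le) hab
  have hWb : 0 ≤ W b := by
    have h := (hg b).nonpos_of_zero_of_pos_left hab (by simp [hb]) hpos
    have hr := Real.rpow_nonneg (ha0.trans hab.le) p
    simp only [hW, hV, hb, mul_zero, zero_sub, zero_add, add_zero] at h ⊢
    have := mul_nonneg (ha0.trans hab.le) (neg_nonneg.2 h)
    rw [mul_neg] at this ⊢
    exact mul_nonneg hr (by simpa using this)
  have hWa : W a ≤ 0 := by
    rcases ha with rfl | ha
    · simp [hW, Real.zero_rpow hp.ne']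
    · have h : 0 ≤ f₁ a * d₂ a := by
        have hneg : HasDerivAt (fun y => f₁ (-y) * f₂ (-y)) (-(f₁ a * d₂ a)) (-a) := by
          have h' : HasDerivAt (fun y => f₁ y * f₂ y) (f₁ a * d₂ a) (- -a) := by
            simpa [ha] using hg a
          exact (h'.comp (-a) (hasDerivAt_neg (-a))).congr_deriv (mul_neg_one _)
        refine neg_nonpos.1 (hneg.nonpos_of_zero_of_pos_left (neg_lt_neg hab) (by simp [ha])
          fun x hx => hpos (-x) ⟨?_, ?_⟩) <;> linarith [hx.1, hx.2]
      have hr := Real.rpow_nonneg ha0 p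
      simp only [hW, hV, ha, mul_zero, zero_sub, add_zero]
      exact mul_nonpos_of_nonneg_of_nonpos hr
        (mul_nonpos_of_nonneg_of_nonpos ha0 (neg_nonpos.2 h))
  linarith

theorem forall_pos_or_forall_neg_of_ne_zero {g : ℝ → ℝ} {a b : ℝ} (hg : Continuous g)
    (h : ∀ x ∈ Set.Ioo a b, g x ≠ 0) :
    (∀ x ∈ Set.Ioo a b, 0 < g x) ∨ ∀ x ∈ Set.Ioo a b, 0 < -g x := by
  by_contra! hc
  obtain ⟨⟨x, hx, hgx⟩, y, hy, hgy⟩ := hc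
  obtain ⟨z, hz, hgz⟩ := isPreconnected_Ioo.intermediate_value hx hy hg.continuousOn
    (show (0 : ℝ) ∈ Set.Icc (g x) (g y) from ⟨hgx, by linarith⟩)
  exact h z hz hgz

theorem exists_coulombPhi_zero_mem_Ioo {η l₁ l₂ a b : ℝ} (h₁ : -1 / 2 < l₁) (h₂ : l₁ < l₂)
    (ha0 : 0 ≤ a) (hab : a < b) (ha : a = 0 ∨ coulombPhi l₂ η a = 0) (hb : coulombPhi l₂ η b = 0)
    (hne : ∀ x ∈ Set.Ioo a b, coulombPhi l₂ η x ≠ 0) :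
    ∃ x ∈ Set.Ioo a b, coulombPhi l₁ η x = 0 := by
  by_contra! hc
  obtain ⟨d₁, dd₁, hf₁, hd₁, ode₁⟩ := exists_hasDerivAt_coulombPhi h₁ η
  obtain ⟨d₂, dd₂, hf₂, hd₂, ode₂⟩ := exists_hasDerivAt_coulombPhi (h₁.trans h₂) η
  have hcont : Continuous fun x => coulombPhi l₁ η x * coulombPhi l₂ η x :=
    continuous_iff_continuousAt.2 fun x => (hf₁ x).continuousAt.mul (hf₂ x).continuousAt
  rcases forall_pos_or_forall_neg_of_ne_zero hcont
    (fun x hx => mul_ne_zero (hc x hx) (hne x hx)) with h | h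
  · exact not_forall_mul_pos_of_coulomb_ode h₁ h₂ hf₁ hd₁ ode₁ hf₂ hd₂ ode₂ ha0 hab ha hb h
  · refine not_forall_mul_pos_of_coulomb_ode h₁ h₂ (fun x => (hf₁ x).neg) (fun x => (hd₁ x).neg)
      (fun x => ?_) hf₂ hd₂ ode₂ ha0 hab ha hb (fun x hx => ?_)
    · simp only [Pi.neg_apply]
      linear_combination -ode₁ x
    · simpa using h x hx

/-- Theorem 4.1: for fixed η and k, the k-th positive zero of F_{ℓ,η} (equivalently of
φ_{ℓ,η}) is strictly increasing in ℓ on (−1/2, ∞). -/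
theorem stmt_8 (η : ℝ) (k : ℕ) (l₁ l₂ : ℝ) (h₁ : -1/2 < l₁) (h₂ : l₁ < l₂) :
    ∀ ρ₁ ρ₂ : ℕ → ℝ, IsPosZeroEnum (coulombPhi l₁ η) ρ₁ →
      IsPosZeroEnum (coulombPhi l₂ η) ρ₂ → ρ₁ k < ρ₂ k := by
  intro ρ₁ ρ₂ e₁ e₂
  obtain ⟨mono₁, zero₁, surj₁⟩ := e₁
  obtain ⟨mono₂, zero₂, surj₂⟩ := e₂
  induction k with
  | zero =>
    obtain ⟨x, hx, hx0⟩ := exists_coulombPhi_zero_mem_Ioo h₁ h₂ le_rfl (zero₂ 0).1 (Or.inl rfl)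
      (zero₂ 0).2 fun x hx h => by
        obtain ⟨j, rfl⟩ := surj₂ x hx.1 h
        exact hx.2.not_ge (mono₂.monotone j.zero_le)
    obtain ⟨j, rfl⟩ := surj₁ x hx.1 hx0
    exact (mono₁.monotone j.zero_le).trans_lt hx.2
  | succ k ih =>
    obtain ⟨x, hx, hx0⟩ := exists_coulombPhi_zero_mem_Ioo h₁ h₂ (zero₂ k).1.le
      (mono₂ k.lt_succ_self) (Or.inr (zero₂ k).2) (zero₂ (k + 1)).2 fun x hx h => by
        obtain ⟨j, rfl⟩ := surj₂ x ((zero₂ k).1.trans hx.1) h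
        have := mono₂.lt_iff_lt.1 hx.1
        have := mono₂.lt_iff_lt.1 hx.2
        omega
    obtain ⟨j, rfl⟩ := surj₁ x ((zero₂ k).1.trans hx.1) hx0
    have hj : k < j := mono₁.lt_iff_lt.1 (ih.trans hx.1)
    exact (mono₁.monotone hj).trans_lt hx.2
end
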